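/- arXiv:2102.04061 — 4 statements merged into one kernel-verified Lean document; each statement's English description precedes it below -/
import Mathlib

section
/- Let b : ℝ^d → ℝ^d and σ : ℝ^d → ℝ^{d×d} be globally Lipschitz with constant L and satisfy |b(0)| + |σ(0)| ≤ L, and suppose σ(x) is invertible for every x ∈ ℝ^d. Define I(x) = inf{ A(φ) : φ ∈ H¹_{x₀}(0,T;ℝ^d), φ(T) = x } where A(φ) = (1/2)∫₀^T |σ(φ(t))^{-1}(φ'(t) − b(φ(t)))|² dt. Then I(x) < +∞ for every x ∈ ℝ^d, and I is continuous on ℝ^d. -/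
open MeasureTheory Set

/-- The set of values `A(φ) = ½∫₀ᵀ |σ(φ(t))⁻¹ (φ'(t) − b(φ(t)))|² dt` over all
`φ ∈ H¹_{x₀}(0,T;ℝ^d)` with `φ(T) = x`; the rate function is `I(x) = inf` of this set. -/
def rateValues (d : ℕ) (T : ℝ) (x₀ : EuclideanSpace ℝ (Fin d))
    (b : EuclideanSpace ℝ (Fin d) → EuclideanSpace ℝ (Fin d))
    (σ : EuclideanSpace ℝ (Fin d) →
      (EuclideanSpace ℝ (Fin d) →L[ℝ] EuclideanSpace ℝ (Fin d)))
    (x : EuclideanSpace ℝ (Fin d)) : Set ℝ :=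
  {r : ℝ | ∃ φ φ' : ℝ → EuclideanSpace ℝ (Fin d),
    IntegrableOn φ' (Icc 0 T) ∧
    IntegrableOn (fun t => ‖φ' t‖ ^ 2) (Icc 0 T) ∧
    (∀ t ∈ Icc (0 : ℝ) T, φ t = x₀ + ∫ s in (0 : ℝ)..t, φ' s) ∧
    φ T = x ∧
    r = (1 / 2) * ∫ t in (0 : ℝ)..T,
      ‖(Ring.inverse (σ (φ t))) (φ' t - b (φ t))‖ ^ 2}

section ControlledPaths

theorem le_add_mul_exp_of_le_add_mul_integral {h : ℝ → ℝ} {a k T : ℝ} (hk : 0 < k)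
    (hc : ContinuousOn h (Icc 0 T)) (h0 : ∀ t ∈ Icc 0 T, 0 ≤ h t)
    (hle : ∀ t ∈ Icc 0 T, h t ≤ a + k * ∫ s in (0 : ℝ)..t, h s) :
    ∀ t ∈ Icc 0 T, h t ≤ a * Real.exp (k * t) := by
  intro t ht
  have hT : (0 : ℝ) ≤ T := ht.1.trans ht.2
  have hint : ∀ u ∈ Icc 0 T, 0 ≤ ∫ s in (0 : ℝ)..u, h s := fun u hu =>
    intervalIntegral.integral_nonneg hu.1 fun s hs => h0 s ⟨hs.1, hs.2.trans hu.2⟩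
  have hcont : ContinuousOn (fun u => ∫ s in (0 : ℝ)..u, h s) (Icc 0 T) := by
    simpa [uIcc_of_le hT] using intervalIntegral.continuousOn_primitive_interval
      (f := h) (a := 0) (b := T) (μ := volume)
      (by simpa [uIcc_of_le hT] using hc.integrableOn_Icc)
  have key := norm_le_gronwallBound_of_norm_deriv_right_le (f' := h) (δ := 0) (K := k) (ε := a)
    hcont (fun u hu => ?_) (by simp) (fun u hu => ?_) t ht
  · rw [Real.norm_of_nonneg (hint t ht), gronwallBound_of_K_ne_0 hk.ne'] at key
    calc h t ≤ a + k * ∫ s in (0 : ℝ)..t, h s := hle t ht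
      _ ≤ a + k * (0 * Real.exp (k * (t - 0)) + a / k * (Real.exp (k * (t - 0)) - 1)) := by
        gcongr
      _ = a * Real.exp (k * t) := by
        rw [sub_zero]
        field_simp
        ring
  · have hsub : Icc u T ⊆ Icc 0 T := Icc_subset_Icc_left hu.1
    have hmem : Ioc u T ∈ nhdsWithin u (Ioi u) := Ioc_mem_nhdsGT hu.2
    refine intervalIntegral.integral_hasDerivWithinAt_right (t := Ioi u) ?_ ?_ ?_
    · exact (hc.mono (Icc_subset_Icc_right hu.2.le)).intervalIntegrable_of_Icc hu.1
    · exact ⟨Ioc u T, hmem, (hc.mono (Ioc_subset_Icc_self.trans hsub)).aestronglyMeasurable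
        measurableSet_Ioc⟩
    · exact ((hc u (Ico_subset_Icc_self hu)).mono
        (Ioc_subset_Icc_self.trans hsub)).mono_of_mem_nhdsWithin hmem
  · have hu' := Ico_subset_Icc_self hu
    rw [Real.norm_of_nonneg (h0 u hu'), Real.norm_of_nonneg (hint u hu')]
    linarith [hle u hu']

theorem sq_integral_mul_le {α : Type*} [MeasurableSpace α] {μ : Measure α} {f g : α → ℝ}
    (hf0 : ∀ x, 0 ≤ f x) (hg0 : ∀ x, 0 ≤ g x) (hf : MemLp f 2 μ) (hg : MemLp g 2 μ) :
    (∫ x, f x * g x ∂μ) ^ 2 ≤ (∫ x, f x ^ 2 ∂μ) * ∫ x, g x ^ 2 ∂μ := by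
  have h := integral_mul_le_Lp_mul_Lq_of_nonneg (μ := μ) (p := 2) (q := 2)
    Real.HolderConjugate.two_two (.of_forall hf0) (.of_forall hg0) (by simpa using hf)
    (by simpa using hg)
  simp only [Real.rpow_two, ← Real.sqrt_eq_rpow] at h
  rw [← Real.sqrt_mul (integral_nonneg fun x => sq_nonneg _)] at h
  have h0 : 0 ≤ ∫ x, f x * g x ∂μ := integral_nonneg fun x => mul_nonneg (hf0 x) (hg0 x)
  exact (Real.le_sqrt h0 (mul_nonneg (integral_nonneg fun x => sq_nonneg _)
    (integral_nonneg fun x => sq_nonneg _))).1 h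

theorem norm_le_mul_one_add_norm {E F : Type*} [NormedAddCommGroup E]
    [NormedAddCommGroup F] {L : NNReal} {f : E → F}
    (hf : LipschitzWith L f) (h0 : ‖f 0‖ ≤ L) (x : E) : ‖f x‖ ≤ L * (1 + ‖x‖) := by
  have h1 := hf.dist_le_mul x 0
  rw [dist_eq_norm, dist_zero_right] at h1
  linarith [norm_le_norm_add_norm_sub' (f x) (f 0)]

variable {E : Type*} [NormedAddCommGroup E] [NormedSpace ℝ E]

/-- The control `u(t) = σ(φ(t))⁻¹ (φ'(t) - b(φ(t)))` driving the path `φ`. -/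
noncomputable def pathControl (b : E → E) (σ : E → (E →L[ℝ] E)) (φ φ' : ℝ → E) (t : ℝ) : E :=
  (Ring.inverse (σ (φ t))) (φ' t - b (φ t))

/-- `φ` is an `H¹` path on `[0, T]` started at `x₀`, with derivative `φ'`. -/
structure IsSobolevPath (T : ℝ) (x₀ : E) (φ φ' : ℝ → E) : Prop where
  memLp : MemLp φ' 2 (volume.restrict (Icc 0 T))
  eq_integral : ∀ t ∈ Icc 0 T, φ t = x₀ + ∫ s in (0 : ℝ)..t, φ' s

theorem apply_control {b : E → E} {σ : E → (E →L[ℝ] E)} (hinv : ∀ x, IsUnit (σ x))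
    (φ φ' : ℝ → E) (t : ℝ) : σ (φ t) (pathControl b σ φ φ' t) = φ' t - b (φ t) := by
  rw [pathControl, ← mul_apply_eq_comp, Ring.mul_inverse_cancel _ (hinv _),
    one_apply_eq_self]

theorem continuous_inverse_comp [CompleteSpace E] {σ : E → (E →L[ℝ] E)} (hσ : Continuous σ)
    (hinv : ∀ x, IsUnit (σ x)) : Continuous fun x => Ring.inverse (σ x) := by
  rw [continuous_iff_continuousAt]
  intro x
  obtain ⟨u, hu⟩ := hinv x
  have h := NormedRing.inverse_continuousAt u
  rw [hu] at h
  exact h.comp hσ.continuousAt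

theorem exists_inverse_bound [ProperSpace E] [CompleteSpace E] {σ : E → (E →L[ℝ] E)}
    (hσ : Continuous σ) (hinv : ∀ x, IsUnit (σ x)) (R : ℝ) :
    ∃ M, 0 ≤ M ∧ ∀ x, ‖x‖ ≤ R → ‖Ring.inverse (σ x)‖ ≤ M := by
  obtain ⟨M, hM⟩ := (isCompact_closedBall (0 : E) R).exists_bound_of_continuousOn
    (continuous_inverse_comp hσ hinv).continuousOn
  exact ⟨max M 0, le_max_right _ _, fun x hx =>
    (hM x (mem_closedBall_zero_iff.2 hx)).trans (le_max_left _ _)⟩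

namespace IsSobolevPath

variable {T : ℝ} {x₀ : E} {φ φ' : ℝ → E}

theorem integrableOn (h : IsSobolevPath T x₀ φ φ') : IntegrableOn φ' (Icc 0 T) :=
  h.memLp.integrable one_le_two

theorem continuousOn (h : IsSobolevPath T x₀ φ φ') : ContinuousOn φ (Icc 0 T) := by
  rcases lt_or_ge T 0 with hT | hT
  · simp [Icc_eq_empty hT.not_ge]
  refine ContinuousOn.congr ?_ h.eq_integral
  refine continuousOn_const.add ?_
  simpa [uIcc_of_le hT] using intervalIntegral.continuousOn_primitive_interval
    (f := φ') (a := 0) (b := T) (μ := volume) (by simpa [uIcc_of_le hT] using h.integrableOn)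

theorem memLp_control [CompleteSpace E] {b : E → E} {σ : E → (E →L[ℝ] E)}
    (hb : Continuous b) (hσ : Continuous σ) (hinv : ∀ x, IsUnit (σ x))
    (h : IsSobolevPath T x₀ φ φ') :
    MemLp (pathControl b σ φ φ') 2 (volume.restrict (Icc 0 T)) := by
  have hS : ContinuousOn (fun t => Ring.inverse (σ (φ t))) (Icc 0 T) :=
    (continuous_inverse_comp hσ hinv).comp_continuousOn h.continuousOn
  have hB : ContinuousOn (fun t => b (φ t)) (Icc 0 T) := hb.comp_continuousOn h.continuousOn
  have hBm : MemLp (fun t => b (φ t)) 2 (volume.restrict (Icc 0 T)) :=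
    (memLp_two_iff_integrable_sq_norm
      (hB.aestronglyMeasurable_of_isCompact isCompact_Icc measurableSet_Icc)).2
      ((hB.norm.pow 2).integrableOn_Icc)
  have hd := h.memLp.sub hBm
  obtain ⟨M, hM⟩ := isCompact_Icc.exists_bound_of_continuousOn hS
  refine hd.of_le_mul (c := M) ?_ ?_
  · exact (ContinuousLinearMap.apply ℝ E).flip.aestronglyMeasurable_comp₂
      (hS.aestronglyMeasurable_of_isCompact isCompact_Icc measurableSet_Icc) hd.1
  · filter_upwards [ae_restrict_mem measurableSet_Icc] with t ht
    exact (ContinuousLinearMap.le_opNorm _ _).trans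
      (mul_le_mul_of_nonneg_right (hM t ht) (norm_nonneg _))

/-- A path is bounded in terms of the energy of its control. -/
theorem sq_one_add_norm_le [CompleteSpace E] {L : NNReal} (hL : 0 < L) {b : E → E}
    {σ : E → (E →L[ℝ] E)} (hb : LipschitzWith L b) (hσ : LipschitzWith L σ)
    (hb0 : ‖b 0‖ ≤ L) (hσ0 : ‖σ 0‖ ≤ L) (hinv : ∀ x, IsUnit (σ x)) (hT : 0 < T)
    (h : IsSobolevPath T x₀ φ φ') {K : ℝ}
    (hK : ∫ t in (0 : ℝ)..T, ‖pathControl b σ φ φ' t‖ ^ 2 ≤ K) {t : ℝ} (ht : t ∈ Icc 0 T) :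
    (1 + ‖φ t‖) ^ 2 ≤
      2 * (1 + ‖x₀‖) ^ 2 * Real.exp (2 * (L ^ 2 * (2 * T + 2 * K)) * T) := by
  set u := pathControl b σ φ φ' with hu
  have hum : MemLp u 2 (volume.restrict (Icc 0 T)) :=
    h.memLp_control hb.continuous hσ.continuous hinv
  have hK0 : 0 ≤ K := (intervalIntegral.integral_nonneg hT.le fun _ _ => sq_nonneg _).trans hK
  set g : ℝ → ℝ := fun s => L * (1 + ‖u s‖) with hg
  set f : ℝ → ℝ := fun s => 1 + ‖φ s‖ with hf
  have hfc : ContinuousOn f (Icc 0 T) := continuousOn_const.add h.continuousOn.norm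
  have hum' : MemLp (fun s => 1 + ‖u s‖) 2 (volume.restrict (Icc 0 T)) :=
    (memLp_const (1 : ℝ)).add hum.norm
  have hgm : MemLp g 2 (volume.restrict (Icc 0 T)) := hum'.const_mul (L : ℝ)
  have hfm : MemLp f 2 (volume.restrict (Icc 0 T)) :=
    (memLp_two_iff_integrable_sq
      (hfc.aestronglyMeasurable_of_isCompact isCompact_Icc measurableSet_Icc)).2
      ((hfc.pow 2).integrableOn_Icc)
  have hu2 : IntegrableOn (fun s => ‖u s‖ ^ 2) (Icc 0 T) :=
    (memLp_two_iff_integrable_sq_norm hum.1).1 hum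
  have hg2 : ∫ s in Icc 0 T, g s ^ 2 ≤ L ^ 2 * (2 * T + 2 * K) := by
    calc ∫ s in Icc 0 T, g s ^ 2 ≤ ∫ s in Icc 0 T, L ^ 2 * (2 + 2 * ‖u s‖ ^ 2) := by
          have hi : IntegrableOn (fun s => L ^ 2 * (2 + 2 * ‖u s‖ ^ 2)) (Icc 0 T) :=
            ((integrable_const (2 : ℝ)).add (hu2.const_mul 2)).const_mul _
          refine integral_mono ((memLp_two_iff_integrable_sq hgm.1).1 hgm) hi fun s => ?_
          simp only [hg, mul_pow]
          gcongr
          nlinarith [sq_nonneg (1 - ‖u s‖)]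
      _ = L ^ 2 * (2 * T + 2 * ∫ s in Icc 0 T, ‖u s‖ ^ 2) := by
          rw [integral_const_mul, integral_add (integrable_const _) (hu2.const_mul 2),
            integral_const_mul]
          simp [hT.le, mul_comm]
      _ ≤ _ := by
          rw [intervalIntegral.integral_of_le hT.le, ← integral_Icc_eq_integral_Ioc] at hK
          gcongr
  have hderiv : ∀ s, ‖φ' s‖ ≤ g s * f s := fun s => by
    have h1 : φ' s = σ (φ s) (u s) + b (φ s) := by rw [hu, apply_control hinv]; abel
    have h2 := (σ (φ s)).le_opNorm (u s)
    have h3 := norm_le_mul_one_add_norm hσ hσ0 (φ s)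
    have h4 := norm_le_mul_one_add_norm hb hb0 (φ s)
    have h5 := mul_le_mul_of_nonneg_right h3 (norm_nonneg (u s))
    calc ‖φ' s‖ ≤ ‖σ (φ s) (u s)‖ + ‖b (φ s)‖ := h1 ▸ norm_add_le _ _
      _ ≤ L * (1 + ‖φ s‖) * ‖u s‖ + L * (1 + ‖φ s‖) := by linarith
      _ = g s * f s := by simp only [hg, hf]; ring
  have hg0 : ∀ s, 0 ≤ g s := fun s => by positivity
  have hf0 : ∀ s, 0 ≤ f s := fun s => by positivity
  have hstep : ∀ t ∈ Icc 0 T, f t ^ 2 ≤ 2 * (1 + ‖x₀‖) ^ 2 +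
      2 * (L ^ 2 * (2 * T + 2 * K)) * ∫ s in (0 : ℝ)..t, f s ^ 2 := fun t ht => by
    have hle : volume.restrict (Ioc 0 t) ≤ volume.restrict (Icc 0 T) :=
      Measure.restrict_mono (Ioc_subset_Icc_self.trans (Icc_subset_Icc_right ht.2)) le_rfl
    have hcs := sq_integral_mul_le hg0 hf0 (hgm.mono_measure hle) (hfm.mono_measure hle)
    have hgt : ∫ s in Ioc 0 t, g s ^ 2 ≤ L ^ 2 * (2 * T + 2 * K) :=
      (integral_mono_measure hle (.of_forall fun s => sq_nonneg _)
        ((memLp_two_iff_integrable_sq hgm.1).1 hgm)).trans hg2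
    have hφ : ‖φ t‖ ≤ ‖x₀‖ + ∫ s in Ioc 0 t, g s * f s := by
      rw [h.eq_integral t ht, intervalIntegral.integral_of_le ht.1]
      have hn : ‖∫ s in Ioc 0 t, φ' s‖ ≤ ∫ s in Ioc 0 t, g s * f s := norm_integral_le_of_norm_le
        ((hgm.mono_measure hle).integrable_mul (hfm.mono_measure hle)) (.of_forall hderiv)
      exact (norm_add_le _ _).trans (by gcongr)
    rw [intervalIntegral.integral_of_le ht.1]
    have hf2 : 0 ≤ ∫ s in Ioc 0 t, f s ^ 2 := integral_nonneg fun s => sq_nonneg _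
    have hm := mul_le_mul_of_nonneg_right hgt hf2
    set J := ∫ s in Ioc 0 t, g s * f s
    have h1 : f t ^ 2 ≤ (1 + ‖x₀‖ + J) ^ 2 :=
      pow_le_pow_left₀ (hf0 t) (by simp only [hf]; linarith) 2
    nlinarith [sq_nonneg (1 + ‖x₀‖ - J)]
  have hkpos : (0 : ℝ) < 2 * (L ^ 2 * (2 * T + 2 * K)) := by positivity
  refine (le_add_mul_exp_of_le_add_mul_integral (h := fun s => f s ^ 2) hkpos (hfc.pow 2)
    (fun s _ => sq_nonneg _)
    hstep t ht).trans ?_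
  have := ht.2
  gcongr

theorem add_linear [CompleteSpace E] (h : IsSobolevPath T x₀ φ φ') (c : E) :
    IsSobolevPath T x₀ (fun t => φ t + t • c) (fun t => φ' t + c) where
  memLp := h.memLp.add (memLp_const c)
  eq_integral t ht := by
    have hi : IntervalIntegrable φ' volume 0 t :=
      (intervalIntegrable_iff_integrableOn_Icc_of_le ht.1).2
        (h.integrableOn.mono_set (Icc_subset_Icc_right ht.2))
    rw [intervalIntegral.integral_add hi intervalIntegrable_const,
      intervalIntegral.integral_const, sub_zero, h.eq_integral t ht, add_assoc]

end IsSobolevPath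

theorem norm_control_add_linear_le {L : NNReal} {b : E → E} {σ : E → (E →L[ℝ] E)}
    (hb : LipschitzWith L b) (hσ : LipschitzWith L σ) (hinv : ∀ x, IsUnit (σ x))
    {φ φ' : ℝ → E} {c : E} {t T M : ℝ} (ht : t ∈ Icc 0 T)
    (hM : ‖Ring.inverse (σ (φ t + t • c))‖ ≤ M) :
    ‖pathControl b σ (fun t => φ t + t • c) (fun t => φ' t + c) t‖ ≤ ‖pathControl b σ φ φ' t‖ +
      M * (L * T + 1) * ‖c‖ * (‖pathControl b σ φ φ' t‖ + 1) := by
  set u := pathControl b σ φ φ' t with hu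
  set ψ := φ t + t • c with hψ
  have hM0 := (norm_nonneg _).trans hM
  have hdist : ‖φ t - ψ‖ ≤ T * ‖c‖ := by
    rw [hψ, sub_add_cancel_left, norm_neg, norm_smul, Real.norm_of_nonneg ht.1]
    exact mul_le_mul_of_nonneg_right ht.2 (norm_nonneg c)
  have hσd : ‖σ (φ t) - σ ψ‖ ≤ L * (T * ‖c‖) := by
    rw [← dist_eq_norm]
    exact (hσ.dist_le_mul _ _).trans (by rw [dist_eq_norm]; gcongr)
  have hbd : ‖b (φ t) - b ψ‖ ≤ L * (T * ‖c‖) := by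
    rw [← dist_eq_norm]
    exact (hb.dist_le_mul _ _).trans (by rw [dist_eq_norm]; gcongr)
  have heq : pathControl b σ (fun t => φ t + t • c) (fun t => φ' t + c) t =
      u + Ring.inverse (σ ψ) ((σ (φ t) - σ ψ) u + (b (φ t) - b ψ) + c) := by
    have h1 : (σ (φ t) - σ ψ) u + (b (φ t) - b ψ) + c = (φ' t + c - b ψ) - σ ψ u := by
      rw [sub_apply, hu, apply_control hinv]
      abel
    have h2 : Ring.inverse (σ ψ) (σ ψ u) = u := by
      rw [← mul_apply_eq_comp, Ring.inverse_mul_cancel _ (hinv _),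
        one_apply_eq_self]
    rw [h1, map_sub, h2, pathControl, ← hψ]
    abel
  rw [heq]
  refine (norm_add_le _ _).trans (add_le_add_right ?_ _)
  have h1 : ‖(σ (φ t) - σ ψ) u + (b (φ t) - b ψ) + c‖ ≤
      L * (T * ‖c‖) * ‖u‖ + L * (T * ‖c‖) + ‖c‖ := by
    refine (norm_add₃_le).trans ?_
    have := ((σ (φ t) - σ ψ).le_opNorm u).trans (mul_le_mul_of_nonneg_right hσd (norm_nonneg u))
    linarith
  calc _ ≤ M * (L * (T * ‖c‖) * ‖u‖ + L * (T * ‖c‖) + ‖c‖) :=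
        (ContinuousLinearMap.le_opNorm _ _).trans (mul_le_mul hM h1 (norm_nonneg _) hM0)
    _ ≤ M * (L * (T * ‖c‖) * ‖u‖ + L * (T * ‖c‖) + (‖c‖ + ‖c‖ * ‖u‖)) := by
        gcongr
        exact le_add_of_nonneg_right (by positivity)
    _ = _ := by ring

theorem sq_le_of_le_add_mul {a v C s : ℝ} (hv0 : 0 ≤ v) (hC : 0 ≤ C) (hs : 0 ≤ s)
    (hs1 : s ≤ 1) (hv : v ≤ a + C * s * (a + 1)) :
    v ^ 2 ≤ a ^ 2 + (3 * C + 2 * C ^ 2) * s * (a ^ 2 + 1) := by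
  have h1 : v ^ 2 ≤ (a + C * s * (a + 1)) ^ 2 := pow_le_pow_left₀ hv0 hv 2
  have h2 : (a + C * s * (a + 1)) ^ 2 ≤
      a ^ 2 + (3 * (C * s) + 2 * (C * s) ^ 2) * (a ^ 2 + 1) := by
    nlinarith [mul_nonneg (mul_nonneg hC hs) (sq_nonneg (a - 1)), mul_nonneg hC hs,
      mul_nonneg (sq_nonneg (C * s)) (sq_nonneg (a - 1)), mul_nonneg (mul_nonneg hC hs) (sq_nonneg a)]
  have h3 : s ^ 2 ≤ s := by nlinarith
  have h4 : (C * s) ^ 2 ≤ C ^ 2 * s := by rw [mul_pow]; gcongr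
  calc v ^ 2 ≤ a ^ 2 + (3 * (C * s) + 2 * (C * s) ^ 2) * (a ^ 2 + 1) := h1.trans h2
    _ ≤ a ^ 2 + (3 * (C * s) + 2 * (C ^ 2 * s)) * (a ^ 2 + 1) := by gcongr
    _ = _ := by ring

end ControlledPaths

theorem mem_rateValues_iff {d : ℕ} {T : ℝ} (hT : 0 ≤ T) {x₀ x : EuclideanSpace ℝ (Fin d)}
    {b : EuclideanSpace ℝ (Fin d) → EuclideanSpace ℝ (Fin d)}
    {σ : EuclideanSpace ℝ (Fin d) → (EuclideanSpace ℝ (Fin d) →L[ℝ] EuclideanSpace ℝ (Fin d))}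
    {r : ℝ} :
    r ∈ rateValues d T x₀ b σ x ↔ ∃ φ φ', IsSobolevPath T x₀ φ φ' ∧ φ T = x ∧
      r = 1 / 2 * ∫ t in Icc 0 T, ‖pathControl b σ φ φ' t‖ ^ 2 := by
  simp only [integral_Icc_eq_integral_Ioc, ← intervalIntegral.integral_of_le hT]
  constructor
  · rintro ⟨φ, φ', h1, h2, h3, h4, h5⟩
    exact ⟨φ, φ', ⟨(memLp_two_iff_integrable_sq_norm h1.1).2 h2, h3⟩, h4, h5⟩
  · rintro ⟨φ, φ', h, h4, h5⟩
    exact ⟨φ, φ', h.integrableOn, (memLp_two_iff_integrable_sq_norm h.memLp.1).1 h.memLp,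
      h.eq_integral, h4, h5⟩

theorem rateValues_nonempty {d : ℕ} {T : ℝ} (hT : 0 < T) (x₀ x : EuclideanSpace ℝ (Fin d))
    (b : EuclideanSpace ℝ (Fin d) → EuclideanSpace ℝ (Fin d))
    (σ : EuclideanSpace ℝ (Fin d) → (EuclideanSpace ℝ (Fin d) →L[ℝ] EuclideanSpace ℝ (Fin d))) :
    (rateValues d T x₀ b σ x).Nonempty := by
  have h0 : IsSobolevPath T x₀ (fun _ => x₀) (fun _ => 0) := ⟨memLp_const 0, by simp⟩
  refine ⟨_, (mem_rateValues_iff hT.le).2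
    ⟨_, _, h0.add_linear (T⁻¹ • (x - x₀)), ?_, rfl⟩⟩
  rw [smul_inv_smul₀ hT.ne']
  abel

theorem nonneg_of_mem_rateValues {d : ℕ} {T : ℝ} (hT : 0 ≤ T)
    {x₀ x : EuclideanSpace ℝ (Fin d)}
    {b : EuclideanSpace ℝ (Fin d) → EuclideanSpace ℝ (Fin d)}
    {σ : EuclideanSpace ℝ (Fin d) → (EuclideanSpace ℝ (Fin d) →L[ℝ] EuclideanSpace ℝ (Fin d))}
    {r : ℝ} (hr : r ∈ rateValues d T x₀ b σ x) : 0 ≤ r := by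
  obtain ⟨φ, φ', -, -, rfl⟩ := (mem_rateValues_iff hT).1 hr
  exact mul_nonneg (by norm_num) (integral_nonneg fun _ => sq_nonneg _)

/-- A value of moderate size at `x` is, up to an error linear in `‖y - x‖`, dominated by a value
at any nearby `y`. -/
theorem exists_mem_rateValues_le_add {d : ℕ} {T : ℝ} (hT : 0 < T)
    (x₀ : EuclideanSpace ℝ (Fin d)) {L : NNReal} (hL : 0 < L)
    {b : EuclideanSpace ℝ (Fin d) → EuclideanSpace ℝ (Fin d)}
    {σ : EuclideanSpace ℝ (Fin d) → (EuclideanSpace ℝ (Fin d) →L[ℝ] EuclideanSpace ℝ (Fin d))}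
    (hb : LipschitzWith L b) (hσ : LipschitzWith L σ) (hb0 : ‖b 0‖ ≤ L) (hσ0 : ‖σ 0‖ ≤ L)
    (hinv : ∀ x, IsUnit (σ x)) (K : ℝ) :
    ∃ D, 0 ≤ D ∧ ∀ x y r, ‖y - x‖ ≤ 1 → r ∈ rateValues d T x₀ b σ x → r ≤ K →
      ∃ r' ∈ rateValues d T x₀ b σ y, r' ≤ r + D * ‖y - x‖ := by
  rcases lt_or_ge K 0 with hK | hK
  · exact ⟨0, le_rfl, fun x y r _ hr hrK =>
      absurd (nonneg_of_mem_rateValues hT.le hr) (hrK.trans_lt hK).not_ge⟩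
  set R := 2 * (1 + ‖x₀‖) ^ 2 * Real.exp (2 * (L ^ 2 * (2 * T + 2 * (2 * K))) * T)
  obtain ⟨M, hM0, hM⟩ := exists_inverse_bound hσ.continuous hinv (R + 1)
  set C := M * (L * T + 1) * T⁻¹ with hC
  have hC0 : 0 ≤ C := by positivity
  refine ⟨(3 * C + 2 * C ^ 2) * (K + T / 2), by positivity, fun x y r hxy hr hrK => ?_⟩
  obtain ⟨φ, φ', hφ, hφT, rfl⟩ := (mem_rateValues_iff hT.le).1 hr
  set c := T⁻¹ • (y - x) with hc
  have hcn : ‖c‖ = T⁻¹ * ‖y - x‖ := by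
    rw [hc, norm_smul, Real.norm_of_nonneg (inv_nonneg.2 hT.le)]
  have hψ := hφ.add_linear c
  refine ⟨_, (mem_rateValues_iff hT.le).2 ⟨_, _, hψ, ?_, rfl⟩, ?_⟩
  · rw [hc, smul_inv_smul₀ hT.ne', hφT]
    abel
  have hint : ∀ {φ φ'}, IsSobolevPath T x₀ φ φ' →
      IntegrableOn (fun t => ‖pathControl b σ φ φ' t‖ ^ 2) (Icc 0 T) := fun h =>
    have hm := h.memLp_control hb.continuous hσ.continuous hinv
    (memLp_two_iff_integrable_sq_norm hm.1).1 hm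
  have hbound : ∀ t ∈ Icc 0 T, ‖φ t‖ ≤ R := fun t ht => by
    have := hφ.sq_one_add_norm_le hL hb hσ hb0 hσ0 hinv hT (K := 2 * K)
      (by rw [intervalIntegral.integral_of_le hT.le, ← integral_Icc_eq_integral_Ioc]; linarith) ht
    nlinarith [norm_nonneg (φ t)]
  have hpt : ∀ t ∈ Icc 0 T,
      ‖pathControl b σ (fun t => φ t + t • c) (fun t => φ' t + c) t‖ ^ 2 ≤
        ‖pathControl b σ φ φ' t‖ ^ 2 +
          (3 * C + 2 * C ^ 2) * ‖y - x‖ * (‖pathControl b σ φ φ' t‖ ^ 2 + 1) := fun t ht => by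
    refine sq_le_of_le_add_mul (norm_nonneg _) hC0 (norm_nonneg _) hxy ?_
    have htc : ‖t • c‖ ≤ 1 := by
      rw [norm_smul, hcn, Real.norm_of_nonneg ht.1, ← mul_assoc, ← div_eq_mul_inv]
      exact mul_le_one₀ ((div_le_one hT).2 ht.2) (norm_nonneg _) hxy
    have := norm_control_add_linear_le (φ' := φ') hb hσ hinv ht
      (hM _ ((norm_add_le _ _).trans (add_le_add (hbound t ht) htc)))
    rwa [hcn, ← mul_assoc (M * (L * T + 1))] at this
  have hint₁ : IntegrableOn (fun t => ‖pathControl b σ φ φ' t‖ ^ 2 + 1) (Icc 0 T) :=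
    (hint hφ).add (integrable_const 1)
  have hint₂ : IntegrableOn (fun t => (3 * C + 2 * C ^ 2) * ‖y - x‖ *
      (‖pathControl b σ φ φ' t‖ ^ 2 + 1)) (Icc 0 T) := hint₁.const_mul _
  have hmono := setIntegral_mono_on (hint hψ) ((hint hφ).add hint₂) measurableSet_Icc hpt
  simp only [Pi.add_apply] at hmono
  rw [integral_add (hint hφ) hint₂, integral_const_mul,
    integral_add (hint hφ) (integrable_const (1 : ℝ))] at hmono
  simp only [integral_const, MeasurableSet.univ, measureReal_restrict_apply, univ_inter,
    Real.volume_real_Icc_of_le hT.le, sub_zero, smul_eq_mul, mul_one] at hmono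
  set I := ∫ t in Icc 0 T, ‖pathControl b σ φ φ' t‖ ^ 2
  have hfin : (3 * C + 2 * C ^ 2) * ‖y - x‖ * (1 / 2 * I) ≤
      (3 * C + 2 * C ^ 2) * ‖y - x‖ * K := by gcongr
  linarith

theorem continuous_sInf_of_exists_le_add {X : Type*} [SeminormedAddCommGroup X] {V : X → Set ℝ}
    (hne : ∀ x, (V x).Nonempty) (h0 : ∀ x, ∀ r ∈ V x, 0 ≤ r)
    (h : ∀ K : ℝ, ∃ D, 0 ≤ D ∧ ∀ x y r, ‖y - x‖ ≤ 1 → r ∈ V x → r ≤ K →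
      ∃ r' ∈ V y, r' ≤ r + D * ‖y - x‖) : Continuous fun x => sInf (V x) := by
  have hbdd : ∀ x, BddBelow (V x) := fun x => ⟨0, fun r hr => h0 x r hr⟩
  have key : ∀ K : ℝ, ∃ D, 0 ≤ D ∧ ∀ x y, ‖y - x‖ ≤ 1 → sInf (V x) < K →
      sInf (V y) ≤ sInf (V x) + D * ‖y - x‖ := fun K => by
    obtain ⟨D, hD, H⟩ := h K
    refine ⟨D, hD, fun x y hxy hx => le_of_forall_gt_imp_ge_of_dense fun a ha => ?_⟩
    have hlt : sInf (V x) < min K (a - D * ‖y - x‖) := lt_min hx (by linarith)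
    obtain ⟨r, hr, hrlt⟩ := exists_lt_of_csInf_lt (hne x) hlt
    obtain ⟨r', hr', hle⟩ := H x y r hxy hr (hrlt.le.trans (min_le_left _ _))
    have := csInf_le (hbdd y) hr'
    have := hrlt.le.trans (min_le_right _ _)
    linarith
  rw [continuous_iff_continuousAt]
  intro x
  obtain ⟨D₁, hD₁, H₁⟩ := key (sInf (V x) + 1)
  obtain ⟨D₂, hD₂, H₂⟩ := key (sInf (V x) + D₁ + 1)
  refine continuousAt_of_locally_lipschitz one_pos (D₁ + D₂) fun y hy => ?_
  rw [dist_eq_norm] at hy ⊢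
  have h1 := H₁ x y hy.le (by linarith)
  have h2 := H₂ y x (by rw [norm_sub_rev]; exact hy.le)
    (by nlinarith [mul_le_mul_of_nonneg_left hy.le hD₁])
  rw [norm_sub_rev] at h2
  have h3 := mul_nonneg hD₁ (norm_nonneg (y - x))
  have h4 := mul_nonneg hD₂ (norm_nonneg (y - x))
  rw [dist_eq_norm, Real.norm_eq_abs, abs_le]
  constructor <;> linarith

/-- Under the global Lipschitz and invertibility assumptions, the rate
function `I(x) = inf{A(φ) : φ ∈ H¹_{x₀}, φ(T) = x}` is finite for every `x`
(the admissible set of values is nonempty) and `I` is continuous on `ℝ^d`. -/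
theorem rate_function_finite_and_continuous
    (d : ℕ) (hd : 1 ≤ d) (T : ℝ) (hT : 0 < T)
    (x₀ : EuclideanSpace ℝ (Fin d)) (L : NNReal) (hL : 0 < L)
    (b : EuclideanSpace ℝ (Fin d) → EuclideanSpace ℝ (Fin d))
    (σ : EuclideanSpace ℝ (Fin d) →
      (EuclideanSpace ℝ (Fin d) →L[ℝ] EuclideanSpace ℝ (Fin d)))
    (hb : LipschitzWith L b) (hσ : LipschitzWith L σ)
    (hbound : ‖b 0‖ + ‖σ 0‖ ≤ (L : ℝ))
    (hinv : ∀ x, IsUnit (σ x)) :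
    (∀ x : EuclideanSpace ℝ (Fin d), (rateValues d T x₀ b σ x).Nonempty) ∧
    Continuous (fun x : EuclideanSpace ℝ (Fin d) => sInf (rateValues d T x₀ b σ x)) := by
  have hb0 : ‖b 0‖ ≤ L := (le_add_of_nonneg_right (norm_nonneg _)).trans hbound
  have hσ0 : ‖σ 0‖ ≤ L := (le_add_of_nonneg_left (norm_nonneg _)).trans hbound
  have hne := fun x => rateValues_nonempty hT x₀ x b σ
  exact ⟨hne, continuous_sInf_of_exists_le_add hne
    (fun x r hr => nonneg_of_mem_rateValues hT.le hr)
    (exists_mem_rateValues_le_add hT x₀ hL hb hσ hb0 hσ0 hinv)⟩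
end

section
/- Let b : ℝ^d → ℝ^d be globally Lipschitz with constant L and |b(0)| ≤ L, and let σ = I_d. Fix θ ∈ [0,1] and T > 0. Define I(x) = inf{ (1/2)∫₀^T |φ'(t) − b(φ(t))|² dt : φ ∈ H¹_{x₀}(0,T;ℝ^d), φ(T) = x } and I^h(x) = inf{ (1/2)∫₀^T |φ'(t) − b((1−θ)φ(t̂) + θφ(ť))|² dt : φ ∈ H¹_{x₀}(0,T;ℝ^d), φ(T) = x }. Then for every R > 0 there exists a constant K₂(R) > 0 such that for all h = T/N with h ∈ (0, min(1/(2L),1)], sup_{|x| ≤ R} |I^h(x) − I(x)| ≤ K₂(R) h. -/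
open MeasureTheory Set

/-- Largest grid point `t_n = n h` below `t`. -/
noncomputable def gridHat (h t : ℝ) : ℝ := h * ⌊t / h⌋

/-- Smallest grid point `t_n = n h` above `t`. -/
noncomputable def gridCheck (h t : ℝ) : ℝ := h * ⌈t / h⌉

/-- Values `½∫₀ᵀ|φ' − b(φ)|²` over `φ ∈ H¹_{x₀}(0,T;ℝ^d)` with `φ(T) = x` (σ = identity);
`I(x)` is their infimum. -/
def rateValuesId (d : ℕ) (T : ℝ) (x₀ : EuclideanSpace ℝ (Fin d))
    (b : EuclideanSpace ℝ (Fin d) → EuclideanSpace ℝ (Fin d))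
    (x : EuclideanSpace ℝ (Fin d)) : Set ℝ :=
  {r : ℝ | ∃ φ φ' : ℝ → EuclideanSpace ℝ (Fin d),
    IntegrableOn φ' (Icc 0 T) ∧
    IntegrableOn (fun t => ‖φ' t‖ ^ 2) (Icc 0 T) ∧
    (∀ t ∈ Icc (0 : ℝ) T, φ t = x₀ + ∫ s in (0 : ℝ)..t, φ' s) ∧
    φ T = x ∧
    r = (1 / 2) * ∫ t in (0 : ℝ)..T, ‖φ' t - b (φ t)‖ ^ 2}

/-- Values of the θ-method functional (σ = identity) over `φ ∈ H¹_{x₀}` with `φ(T) = x`;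
`I^h(x)` is their infimum (`h = T/N`). -/
noncomputable def rateValuesIdH (d : ℕ) (T : ℝ) (x₀ : EuclideanSpace ℝ (Fin d)) (θ : ℝ)
    (b : EuclideanSpace ℝ (Fin d) → EuclideanSpace ℝ (Fin d))
    (h : ℝ) (x : EuclideanSpace ℝ (Fin d)) : Set ℝ :=
  {r : ℝ | ∃ φ φ' : ℝ → EuclideanSpace ℝ (Fin d),
    IntegrableOn φ' (Icc 0 T) ∧
    IntegrableOn (fun t => ‖φ' t‖ ^ 2) (Icc 0 T) ∧
    (∀ t ∈ Icc (0 : ℝ) T, φ t = x₀ + ∫ s in (0 : ℝ)..t, φ' s) ∧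
    φ T = x ∧
    r = (1 / 2) * ∫ t in (0 : ℝ)..T,
      ‖φ' t - b ((1 - θ) • φ (gridHat h t) + θ • φ (gridCheck h t))‖ ^ 2}

lemma norm_le_of_lipschitz {E : Type*} [NormedAddCommGroup E] {b : E → E} {L : NNReal} (hb : LipschitzWith L b)
    (hb0 : ‖b 0‖ ≤ (L : ℝ)) (y : E) : ‖b y‖ ≤ L * (1 + ‖y‖) := by
  have h1 := hb.norm_sub_le y 0
  have h2 := norm_add_le (b y - b 0) (b 0)
  rw [sub_add_cancel] at h2
  rw [sub_zero] at h1
  linarith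

section SampledAction

variable {E : Type*} [NormedAddCommGroup E] [NormedSpace ℝ E]

/-- `φ` is the path on `[0, T]` starting at `x₀` with square-integrable derivative `v`. -/
structure IsH1Path (T : ℝ) (x₀ : E) (φ v : ℝ → E) : Prop where
  integrable : IntegrableOn v (Icc 0 T)
  integrable_sq : IntegrableOn (fun t => ‖v t‖ ^ 2) (Icc 0 T)
  eq_integral : ∀ t ∈ Icc (0 : ℝ) T, φ t = x₀ + ∫ s in (0 : ℝ)..t, v s

/-- On each grid cell, `ψ` stays within the length of `φ` over that cell of the value of `φ` at the
left end of the cell. -/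
structure IsSampling (h : ℝ) (N : ℕ) (φ v ψ : ℝ → E) : Prop where
  aesm : AEStronglyMeasurable ψ (volume.restrict (Icc 0 (N * h)))
  close : ∀ n < N, ∀ t ∈ Icc ((n : ℝ) * h) ((n + 1 : ℕ) * h),
    ‖ψ t - φ (n * h)‖ ≤ ∫ s in ((n : ℝ) * h)..((n + 1 : ℕ) * h), ‖v s‖

/-- Values of `½∫₀ᵀ|φ' − b(S φ)|²` over `H¹` paths from `x₀` to `x`, for a sampling operator `S`. -/
def sampledActionValues (T : ℝ) (x₀ : E) (b : E → E) (S : (ℝ → E) → ℝ → E) (x : E) : Set ℝ :=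
  {r : ℝ | ∃ φ v : ℝ → E, IsH1Path T x₀ φ v ∧ φ T = x ∧
    r = (1 / 2) * ∫ t in (0 : ℝ)..T, ‖v t - b (S φ t)‖ ^ 2}

lemma grid_mem_Icc {h : ℝ} (hh : 0 ≤ h) {n N : ℕ} (hn : n ≤ N) :
    (n : ℝ) * h ∈ Icc 0 (N * h) :=
  ⟨by positivity, by gcongr⟩

lemma grid_le_succ {h : ℝ} (hh : 0 ≤ h) (n : ℕ) : (n : ℝ) * h ≤ (n + 1 : ℕ) * h := by
  gcongr; omega

lemma intervalIntegrable_of_Icc {F : Type*} [NormedAddCommGroup F] {f : ℝ → F} {T α β : ℝ}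
    (hf : IntegrableOn f (Icc 0 T)) (hα : α ∈ Icc 0 T) (hβ : β ∈ Icc 0 T) :
    IntervalIntegrable f volume α β :=
  (hf.mono_set (uIcc_subset_Icc hα hβ)).intervalIntegrable

/-- Gluing a bound on each cell to a bound on the whole interval. -/
lemma integral_le_of_cells {f g : ℝ → ℝ} {h : ℝ} {N : ℕ} (hh : 0 ≤ h)
    (hf : IntegrableOn f (Icc 0 (N * h))) (hg : IntegrableOn g (Icc 0 (N * h)))
    (hfg : ∀ n < N, ∫ t in ((n : ℝ) * h)..((n + 1 : ℕ) * h), f t ≤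
      ∫ t in ((n : ℝ) * h)..((n + 1 : ℕ) * h), g t) :
    ∫ t in (0 : ℝ)..(N * h), f t ≤ ∫ t in (0 : ℝ)..(N * h), g t := by
  have key : ∀ k : ℝ → ℝ, IntegrableOn k (Icc 0 (N * h)) →
      ∑ n ∈ Finset.range N, ∫ t in ((n : ℝ) * h)..((n + 1 : ℕ) * h), k t =
        ∫ t in (0 : ℝ)..(N * h), k t := by
    intro k hk
    have := intervalIntegral.sum_integral_adjacent_intervals (a := fun n : ℕ => (n : ℝ) * h)
      (f := k) (μ := volume) (n := N) (fun n hn => intervalIntegrable_of_Icc hk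
        (grid_mem_Icc hh hn.le) (grid_mem_Icc hh hn))
    simpa using this
  rw [← key f hf, ← key g hg]
  exact Finset.sum_le_sum fun n hn => hfg n (Finset.mem_range.1 hn)

lemma sq_integral_le {f : ℝ → ℝ} {α β : ℝ} (hαβ : α ≤ β)
    (hf : IntervalIntegrable f volume α β)
    (hf2 : IntervalIntegrable (fun t => f t ^ 2) volume α β) :
    (∫ t in α..β, f t) ^ 2 ≤ (β - α) * ∫ t in α..β, f t ^ 2 := by
  rcases hαβ.eq_or_lt with rfl | hlt
  · simp
  set c := ∫ t in α..β, f t with hc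
  have hpos : 0 < β - α := sub_pos.2 hlt
  have h0 : 0 ≤ ∫ t in α..β, (f t - c / (β - α)) ^ 2 :=
    intervalIntegral.integral_nonneg hαβ fun t _ => sq_nonneg _
  have heq : ∫ t in α..β, (f t - c / (β - α)) ^ 2 =
      (∫ t in α..β, f t ^ 2) - 2 * (c / (β - α)) * c + (β - α) * (c / (β - α)) ^ 2 := by
    have : (fun t => (f t - c / (β - α)) ^ 2) =
        fun t => (f t ^ 2 - 2 * (c / (β - α)) * f t) + (c / (β - α)) ^ 2 := by
      funext t; ring
    rw [this, intervalIntegral.integral_add (hf2.sub (hf.const_mul _)) (by simp),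
      intervalIntegral.integral_sub hf2 (hf.const_mul _), intervalIntegral.integral_const_mul]
    simp [hc]
  rw [heq] at h0
  have : (β - α) * ((∫ t in α..β, f t ^ 2) - 2 * (c / (β - α)) * c +
      (β - α) * (c / (β - α)) ^ 2) = (β - α) * (∫ t in α..β, f t ^ 2) - c ^ 2 := by
    field_simp; ring
  nlinarith [mul_nonneg hpos.le h0]

namespace IsH1Path

variable {T : ℝ} {x₀ : E} {φ v : ℝ → E}

lemma norm_sub_le (hφ : IsH1Path T x₀ φ v) {α β t : ℝ} (hα : 0 ≤ α) (hβ : β ≤ T)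
    (ht : t ∈ Icc α β) : ‖φ t - φ α‖ ≤ ∫ s in α..β, ‖v s‖ := by
  have h0 : (0 : ℝ) ∈ Icc 0 T := ⟨le_rfl, hα.trans (ht.1.trans (ht.2.trans hβ))⟩
  have hαm : α ∈ Icc 0 T := ⟨hα, ht.1.trans (ht.2.trans hβ)⟩
  have htm : t ∈ Icc 0 T := ⟨hα.trans ht.1, ht.2.trans hβ⟩
  have hβm : β ∈ Icc 0 T := ⟨htm.1.trans ht.2, hβ⟩
  have hi := @intervalIntegrable_of_Icc E _ v T
  rw [hφ.eq_integral t htm, hφ.eq_integral α hαm, add_sub_add_left_eq_sub,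
    intervalIntegral.integral_interval_sub_left (hi hφ.integrable h0 htm)
      (hi hφ.integrable h0 hαm)]
  refine (intervalIntegral.norm_integral_le_integral_norm ht.1).trans ?_
  exact intervalIntegral.integral_mono_interval le_rfl ht.1 ht.2
    (Filter.Eventually.of_forall fun s => norm_nonneg _) (hi hφ.integrable hαm hβm).norm

lemma continuousOn (hφ : IsH1Path T x₀ φ v) : ContinuousOn φ (Icc 0 T) := by
  rcases le_or_gt 0 T with hT | hT
  · have h := intervalIntegral.continuousOn_primitive_interval (μ := volume) (f := v) (a := 0)
      (b := T) (by rw [uIcc_of_le hT]; exact hφ.integrable)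
    rw [uIcc_of_le hT] at h
    exact (continuousOn_const.add h).congr hφ.eq_integral
  · simp [Icc_eq_empty hT.not_ge]

lemma isSampling_self {h : ℝ} {N : ℕ} (hh : 0 ≤ h) (hφ : IsH1Path (N * h) x₀ φ v) :
    IsSampling h N φ v φ where
  aesm := hφ.continuousOn.aestronglyMeasurable measurableSet_Icc
  close _ hn _ ht :=
    hφ.norm_sub_le (grid_mem_Icc hh hn.le).1 (grid_mem_Icc hh (Nat.succ_le_of_lt hn)).2 ht

/-- Length of the path up to a sample time bounds the sample. -/
lemma norm_sampling_le {h : ℝ} {N : ℕ} (hh : 0 ≤ h) (hφ : IsH1Path (N * h) x₀ φ v)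
    {ψ : ℝ → E} (hψ : IsSampling h N φ v ψ) {n : ℕ} (hn : n < N) {t : ℝ}
    (ht : t ∈ Icc ((n : ℝ) * h) ((n + 1 : ℕ) * h)) :
    ‖ψ t‖ ≤ ‖x₀‖ + ∫ s in (0 : ℝ)..((n + 1 : ℕ) * h), ‖v s‖ := by
  have hnm := grid_mem_Icc hh hn.le
  have h0 := grid_mem_Icc hh (Nat.zero_le N)
  have hnm' := grid_mem_Icc hh (Nat.succ_le_of_lt hn)
  have h1 := hψ.close n hn t ht
  have h2 := hφ.norm_sub_le le_rfl hnm.2 (t := n * h) ⟨hnm.1, le_rfl⟩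
  have h3 : φ 0 = x₀ := by
    simpa using hφ.eq_integral 0 (by simpa using h0)
  rw [h3] at h2
  have hi := intervalIntegrable_of_Icc hφ.integrable.norm (show (0 : ℝ) ∈ _ by simpa using h0) hnm
  have hi' := intervalIntegrable_of_Icc hφ.integrable.norm hnm hnm'
  rw [← intervalIntegral.integral_add_adjacent_intervals hi hi']
  have := norm_add_le (ψ t - φ (n * h)) (φ (n * h) - x₀)
  have := norm_add_le ((ψ t - φ (n * h)) + (φ (n * h) - x₀)) x₀
  simp only [sub_add_sub_cancel, sub_add_cancel] at *
  linarith

lemma norm_sampling_le_total {h : ℝ} {N : ℕ} (hh : 0 < h) (hN : 0 < N)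
    (hφ : IsH1Path (N * h) x₀ φ v) {ψ : ℝ → E} (hψ : IsSampling h N φ v ψ) {t : ℝ}
    (ht : t ∈ Icc 0 (N * h)) :
    ‖ψ t‖ ≤ ‖x₀‖ + ∫ s in (0 : ℝ)..(N * h), ‖v s‖ := by
  obtain ⟨n, hn, htn⟩ : ∃ n < N, t ∈ Icc ((n : ℝ) * h) ((n + 1 : ℕ) * h) := by
    rcases ht.2.eq_or_lt with rfl | hlt
    · refine ⟨N - 1, by omega, ?_, ?_⟩
      · gcongr; omega
      · rw [Nat.sub_add_cancel hN]
    · refine ⟨⌊t / h⌋₊, (Nat.floor_lt (div_nonneg ht.1 hh.le)).2 ((div_lt_iff₀ hh).2 hlt), ?_, ?_⟩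
      · exact (le_div_iff₀ hh).1 (Nat.floor_le (div_nonneg ht.1 hh.le))
      · push_cast
        exact ((div_lt_iff₀ hh).1 (Nat.lt_floor_add_one (t / h))).le
  refine (hφ.norm_sampling_le hh.le hψ hn htn).trans ?_
  have hm := grid_mem_Icc hh.le (Nat.succ_le_of_lt hn)
  gcongr
  exact intervalIntegral.integral_mono_interval le_rfl hm.1 hm.2
    (Filter.Eventually.of_forall fun s => norm_nonneg _)
    (intervalIntegrable_of_Icc hφ.integrable.norm ⟨le_rfl, hm.1.trans hm.2⟩
      ⟨hm.1.trans hm.2, le_rfl⟩)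

end IsH1Path

/-- An implicit discrete Grönwall inequality. -/
lemma implicit_discrete_gronwall {p δ : ℕ → ℝ} {a x : ℝ} {N : ℕ} (hx : 0 ≤ x) (hx' : x ≤ 1 / 2)
    (ha : 0 ≤ a) (hp0 : p 0 ≤ a) (hδ : ∀ n, 0 ≤ δ n)
    (hrec : ∀ n < N, p (n + 1) ≤ p n + x * (1 + p (n + 1)) + δ n) :
    ∀ n ≤ N, p n ≤ Real.exp (2 * x * n) * (a + 2 * x * n + 2 * ∑ i ∈ Finset.range n, δ i) := by
  intro n
  induction n with
  | zero => intro _; simpa using hp0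
  | succ n ih =>
    intro hn
    have h1 := ih (by omega)
    have h2 := hrec n (by omega)
    have hS : 0 ≤ ∑ i ∈ Finset.range n, δ i := Finset.sum_nonneg fun i _ => hδ i
    have hstep : p (n + 1) ≤ (1 + 2 * x) * max (p n) 0 + 2 * x + 2 * δ n := by
      have hm := le_max_left (p n) 0
      have hm0 := le_max_right (p n) 0
      have := hδ n
      have h3 : (1 - x) * p (n + 1) ≤ max (p n) 0 + x + δ n := by linarith
      have h4 : max (p n) 0 + x + δ n ≤
          (1 - x) * ((1 + 2 * x) * max (p n) 0 + 2 * x + 2 * δ n) := by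
        have hc : 0 ≤ x * (1 - 2 * x) := mul_nonneg hx (by linarith)
        nlinarith [mul_nonneg hc hm0, mul_nonneg (sub_nonneg.2 hx') this]
      exact le_of_mul_le_mul_left (h3.trans h4) (by linarith)
    have hmax : max (p n) 0 ≤
        Real.exp (2 * x * n) * (a + 2 * x * n + 2 * ∑ i ∈ Finset.range n, δ i) :=
      max_le h1 (by positivity)
    have he : 1 + 2 * x ≤ Real.exp (2 * x) := by linarith [Real.add_one_le_exp (2 * x)]
    have hsplit : Real.exp (2 * x * (n + 1 : ℕ)) = Real.exp (2 * x) * Real.exp (2 * x * n) := by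
      rw [← Real.exp_add]; congr 1; push_cast; ring
    have hone : 1 ≤ Real.exp (2 * x * (n + 1 : ℕ)) := Real.one_le_exp (by positivity)
    have hlast : 0 ≤ 2 * x + 2 * δ n := by have := hδ n; positivity
    have hprod : (1 + 2 * x) * max (p n) 0 ≤ Real.exp (2 * x) *
        (Real.exp (2 * x * n) * (a + 2 * x * n + 2 * ∑ i ∈ Finset.range n, δ i)) := by
      gcongr
    have h5 : 2 * x + 2 * δ n ≤ Real.exp (2 * x * (n + 1 : ℕ)) * (2 * x + 2 * δ n) :=
      le_mul_of_one_le_left hlast hone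
    rw [Finset.sum_range_succ]
    calc p (n + 1) ≤ (1 + 2 * x) * max (p n) 0 + (2 * x + 2 * δ n) := by linarith
      _ ≤ Real.exp (2 * x) *
        (Real.exp (2 * x * n) * (a + 2 * x * n + 2 * ∑ i ∈ Finset.range n, δ i)) +
          Real.exp (2 * x * (n + 1 : ℕ)) * (2 * x + 2 * δ n) := add_le_add hprod h5
      _ = _ := by rw [hsplit]; push_cast; ring

section Comparison

variable {h : ℝ} {N : ℕ} {x₀ : E} {φ v ψ : ℝ → E} {b : E → E} {L : NNReal}

lemma IsSampling.memLp_comp (hh : 0 < h) (hN : 0 < N) (hφ : IsH1Path (N * h) x₀ φ v)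
    (hψ : IsSampling h N φ v ψ) (hb : LipschitzWith L b) (hb0 : ‖b 0‖ ≤ (L : ℝ)) :
    MemLp (fun t => b (ψ t)) 2 (volume.restrict (Icc 0 (N * h))) := by
  refine MemLp.of_bound (hb.continuous.comp_aestronglyMeasurable hψ.aesm)
    (L * (1 + (‖x₀‖ + ∫ s in (0 : ℝ)..(N * h), ‖v s‖))) ?_
  refine (ae_restrict_iff' measurableSet_Icc).2 (Filter.Eventually.of_forall fun t ht => ?_)
  refine (norm_le_of_lipschitz hb hb0 _).trans ?_
  gcongr
  exact hφ.norm_sampling_le_total hh hN hψ ht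

lemma IsH1Path.memLp {T : ℝ} (hφ : IsH1Path T x₀ φ v) :
    MemLp v 2 (volume.restrict (Icc 0 T)) :=
  (memLp_two_iff_integrable_sq_norm hφ.integrable.aestronglyMeasurable).2 hφ.integrable_sq

/-- Length bound by the implicit Grönwall inequality. -/
lemma IsH1Path.length_le (hh : 0 < h) (hN : 0 < N) (hφ : IsH1Path (N * h) x₀ φ v)
    (hψ : IsSampling h N φ v ψ) (hb : LipschitzWith L b) (hb0 : ‖b 0‖ ≤ (L : ℝ))
    (hLh : L * h ≤ 1 / 2) :
    ‖x₀‖ + ∫ s in (0 : ℝ)..(N * h), ‖v s‖ ≤ Real.exp (2 * L * (N * h)) *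
      (‖x₀‖ + 2 * L * (N * h) + 2 * ∫ t in (0 : ℝ)..(N * h), ‖v t - b (ψ t)‖) := by
  have hu := ((hφ.memLp.sub (hψ.memLp_comp hh hN hφ hb hb0)).integrable one_le_two).norm
  replace hu : IntegrableOn (fun t => ‖v t - b (ψ t)‖) (Icc 0 (N * h)) := hu
  have hvi := hφ.integrable.norm
  have hsum := intervalIntegral.sum_integral_adjacent_intervals (a := fun n : ℕ => (n : ℝ) * h)
      (f := fun t => ‖v t - b (ψ t)‖) (μ := volume) (n := N) (fun n hn =>
        intervalIntegrable_of_Icc hu (grid_mem_Icc hh.le hn.le) (grid_mem_Icc hh.le hn))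
  have key := implicit_discrete_gronwall (N := N) (x := L * h) (a := ‖x₀‖)
    (p := fun n : ℕ => ‖x₀‖ + ∫ s in (0 : ℝ)..(n * h), ‖v s‖)
    (δ := fun n : ℕ => ∫ t in ((n : ℝ) * h)..((n + 1 : ℕ) * h), ‖v t - b (ψ t)‖)
    (by positivity) hLh (norm_nonneg _) (by simp)
    (fun n => intervalIntegral.integral_nonneg (grid_le_succ hh.le n) fun t _ => norm_nonneg _)
    (fun n hn => ?_) N le_rfl
  · rw [hsum] at key
    simp only [Nat.cast_zero, zero_mul] at key
    convert key using 2 <;> ring_nf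
  · have h0 : (0 : ℝ) ∈ Icc 0 (N * h) := by simpa using grid_mem_Icc hh.le (Nat.zero_le N)
    have hnm := grid_mem_Icc hh.le hn.le
    have hnm' := grid_mem_Icc hh.le (Nat.succ_le_of_lt hn)
    have hui := intervalIntegrable_of_Icc hu hnm hnm'
    have hvi' := intervalIntegrable_of_Icc hvi hnm hnm'
    have hadd := intervalIntegral.integral_add_adjacent_intervals
      (intervalIntegrable_of_Icc hvi h0 hnm) hvi'
    set P := ‖x₀‖ + ∫ s in (0 : ℝ)..((n + 1 : ℕ) * h), ‖v s‖ with hP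
    have hcell : ∫ s in ((n : ℝ) * h)..((n + 1 : ℕ) * h), ‖v s‖ ≤
        ∫ s in ((n : ℝ) * h)..((n + 1 : ℕ) * h), (‖v s - b (ψ s)‖ + L * (1 + P)) := by
      refine intervalIntegral.integral_mono_on (grid_le_succ hh.le n) hvi'
        (hui.add (by simp)) fun t ht => ?_
      have h1 := norm_add_le (v t - b (ψ t)) (b (ψ t))
      rw [sub_add_cancel] at h1
      have h2 := norm_le_of_lipschitz hb hb0 (ψ t)
      have h3 : (L : ℝ) * (1 + ‖ψ t‖) ≤ L * (1 + P) := by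
        gcongr
        exact hφ.norm_sampling_le hh.le hψ hn ht
      linarith
    rw [intervalIntegral.integral_add hui (by simp), intervalIntegral.integral_const] at hcell
    have hw : (((n + 1 : ℕ) : ℝ) * h - n * h) • ((L : ℝ) * (1 + P)) = L * h * (1 + P) := by
      push_cast; rw [smul_eq_mul]; ring
    rw [hw] at hcell
    linarith

/-- Moving from one sampling of a path to another changes the action by `O(h)`, with a constant
depending only on the action of the path. -/
lemma IsH1Path.action_le_action_add (hh : 0 < h) (hh1 : h ≤ 1) (hN : 0 < N)
    (hφ : IsH1Path (N * h) x₀ φ v) {χ : ℝ → E}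
    (hψ : IsSampling h N φ v ψ) (hχ : IsSampling h N φ v χ) (hb : LipschitzWith L b)
    (hb0 : ‖b 0‖ ≤ (L : ℝ)) (hLh : L * h ≤ 1 / 2) {A B : ℝ}
    (hA : (1 / 2) * ∫ t in (0 : ℝ)..(N * h), ‖v t - b (ψ t)‖ ^ 2 ≤ A)
    (hB : L * (1 + Real.exp (2 * L * (N * h)) *
      (‖x₀‖ + 2 * L * (N * h) + (N * h + 2 * A))) ≤ B) :
    (1 / 2) * ∫ t in (0 : ℝ)..(N * h), ‖v t - b (χ t)‖ ^ 2 ≤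
      (1 / 2) * (∫ t in (0 : ℝ)..(N * h), ‖v t - b (ψ t)‖ ^ 2) +
        (A + 4 * L ^ 2 * (4 * A + 2 * (N * h) * B ^ 2)) * h := by
  set T : ℝ := N * h with hT
  have hTpos : 0 ≤ T := by positivity
  have h0 : (0 : ℝ) ∈ Icc 0 T := ⟨le_rfl, hTpos⟩
  have hTm : T ∈ Icc 0 T := ⟨hTpos, le_rfl⟩
  have hψL := hψ.memLp_comp hh hN hφ hb hb0
  have hχL := hχ.memLp_comp hh hN hφ hb hb0
  have hv2 := intervalIntegrable_of_Icc hφ.integrable_sq h0 hTm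
  have hu : IntegrableOn (fun t => ‖v t - b (ψ t)‖) (Icc 0 T) :=
    ((hφ.memLp.sub hψL).integrable one_le_two).norm
  have hu2 : IntegrableOn (fun t => ‖v t - b (ψ t)‖ ^ 2) (Icc 0 T) :=
    (hφ.memLp.sub hψL).integrable_norm_pow two_ne_zero
  have hw2 : IntegrableOn (fun t => ‖v t - b (χ t)‖ ^ 2) (Icc 0 T) :=
    (hφ.memLp.sub hχL).integrable_norm_pow two_ne_zero
  have he2 : IntegrableOn (fun t => ‖b (ψ t) - b (χ t)‖ ^ 2) (Icc 0 T) :=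
    (hψL.sub hχL).integrable_norm_pow two_ne_zero
  have hui := intervalIntegrable_of_Icc hu h0 hTm
  have hu2i := intervalIntegrable_of_Icc hu2 h0 hTm
  have hw2i := intervalIntegrable_of_Icc hw2 h0 hTm
  have he2i := intervalIntegrable_of_Icc he2 h0 hTm
  have hA0 : 0 ≤ ∫ t in (0 : ℝ)..T, ‖v t - b (ψ t)‖ ^ 2 :=
    intervalIntegral.integral_nonneg hTpos fun t _ => sq_nonneg _
  -- the total length and hence the drift along the path are bounded
  have hu1 : 2 * ∫ t in (0 : ℝ)..T, ‖v t - b (ψ t)‖ ≤ T + 2 * A := by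
    have : ∫ t in (0 : ℝ)..T, 2 * ‖v t - b (ψ t)‖ ≤
        ∫ t in (0 : ℝ)..T, (1 + ‖v t - b (ψ t)‖ ^ 2) :=
      intervalIntegral.integral_mono_on hTpos (hui.const_mul 2)
        (IntervalIntegrable.add (by simp) hu2i)
        fun t _ => by nlinarith [sq_nonneg (‖v t - b (ψ t)‖ - 1)]
    rw [intervalIntegral.integral_const_mul, intervalIntegral.integral_add (by simp) hu2i] at this
    simp only [intervalIntegral.integral_const, sub_zero, smul_eq_mul, mul_one] at this
    linarith
  have hdrift : ∀ t ∈ Icc 0 T, ‖b (ψ t)‖ ≤ B := by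
    intro t ht
    refine (norm_le_of_lipschitz hb hb0 _).trans (le_trans ?_ hB)
    gcongr
    refine (hφ.norm_sampling_le_total hh hN hψ ht).trans
      ((hφ.length_le hh hN hψ hb hb0 hLh).trans ?_)
    gcongr
  have hD : ∫ t in (0 : ℝ)..T, ‖v t‖ ^ 2 ≤ 4 * A + 2 * T * B ^ 2 := by
    have : ∫ t in (0 : ℝ)..T, ‖v t‖ ^ 2 ≤
        ∫ t in (0 : ℝ)..T, (2 * ‖v t - b (ψ t)‖ ^ 2 + 2 * B ^ 2) := by
      refine intervalIntegral.integral_mono_on hTpos hv2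
        ((hu2i.const_mul 2).add (by simp)) fun t ht => ?_
      have h1 := norm_add_le (v t - b (ψ t)) (b (ψ t))
      rw [sub_add_cancel] at h1
      have h2 := hdrift t ht
      have h3 : ‖v t‖ ≤ ‖v t - b (ψ t)‖ + B := by linarith
      have h4 : ‖v t‖ ^ 2 ≤ (‖v t - b (ψ t)‖ + B) ^ 2 := by gcongr
      nlinarith [sq_nonneg (‖v t - b (ψ t)‖ - B)]
    rw [intervalIntegral.integral_add (hu2i.const_mul 2) (by simp),
      intervalIntegral.integral_const_mul] at this
    simp only [intervalIntegral.integral_const, sub_zero, smul_eq_mul] at this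
    linarith
  -- the sampling error is of size `h` in `L²`
  have herr : ∫ t in (0 : ℝ)..T, ‖b (ψ t) - b (χ t)‖ ^ 2 ≤
      4 * L ^ 2 * h ^ 2 * ∫ t in (0 : ℝ)..T, ‖v t‖ ^ 2 := by
    rw [← intervalIntegral.integral_const_mul]
    refine integral_le_of_cells hh.le he2 (hφ.integrable_sq.const_mul _) fun n hn => ?_
    have hnm := grid_mem_Icc hh.le hn.le
    have hnm' := grid_mem_Icc hh.le (Nat.succ_le_of_lt hn)
    set c := ∫ s in ((n : ℝ) * h)..((n + 1 : ℕ) * h), ‖v s‖ with hc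
    have hwidth : ((n + 1 : ℕ) : ℝ) * h - n * h = h := by push_cast; ring
    have hcs := sq_integral_le (grid_le_succ hh.le n)
      (intervalIntegrable_of_Icc hφ.integrable.norm hnm hnm')
      (intervalIntegrable_of_Icc hφ.integrable_sq hnm hnm')
    rw [hwidth] at hcs
    have hb2 : ∫ t in ((n : ℝ) * h)..((n + 1 : ℕ) * h), ‖b (ψ t) - b (χ t)‖ ^ 2 ≤
        ∫ t in ((n : ℝ) * h)..((n + 1 : ℕ) * h), (L * (2 * c)) ^ 2 := by
      refine intervalIntegral.integral_mono_on (grid_le_succ hh.le n)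
        (intervalIntegrable_of_Icc he2 hnm hnm') (by simp) fun t ht => ?_
      have h1 := hb.norm_sub_le (ψ t) (χ t)
      have h2 : ‖ψ t - χ t‖ ≤ 2 * c := by
        have h3 := _root_.norm_sub_le (ψ t - φ (n * h)) (χ t - φ (n * h))
        rw [sub_sub_sub_cancel_right] at h3
        linarith [hψ.close n hn t ht, hχ.close n hn t ht]
      have h4 : ‖b (ψ t) - b (χ t)‖ ≤ L * (2 * c) := h1.trans (by gcongr)
      gcongr
    rw [intervalIntegral.integral_const, hwidth, smul_eq_mul] at hb2
    rw [intervalIntegral.integral_const_mul]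
    refine hb2.trans ?_
    have := mul_le_mul_of_nonneg_left hcs (show (0 : ℝ) ≤ 4 * L ^ 2 * h by positivity)
    linarith
  -- Young's inequality with weight `h`
  have hfin : ∫ t in (0 : ℝ)..T, ‖v t - b (χ t)‖ ^ 2 ≤
      ∫ t in (0 : ℝ)..T, ((1 + h) * ‖v t - b (ψ t)‖ ^ 2 +
        (1 + h⁻¹) * ‖b (ψ t) - b (χ t)‖ ^ 2) := by
    refine intervalIntegral.integral_mono_on hTpos hw2i
      ((hu2i.const_mul _).add (he2i.const_mul _)) fun t _ => ?_
    have h1 := norm_add_le (v t - b (ψ t)) (b (ψ t) - b (χ t))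
    rw [sub_add_sub_cancel] at h1
    set p := ‖v t - b (ψ t)‖
    set q := ‖b (ψ t) - b (χ t)‖
    have h2 : ‖v t - b (χ t)‖ ^ 2 ≤ (p + q) ^ 2 := by gcongr
    have h3 : 0 ≤ h⁻¹ * (h * p - q) ^ 2 := by positivity
    have h4 : h⁻¹ * (h * p - q) ^ 2 = h * p ^ 2 - 2 * p * q + h⁻¹ * q ^ 2 := by
      field_simp; ring
    nlinarith
  rw [intervalIntegral.integral_add (hu2i.const_mul _) (he2i.const_mul _),
    intervalIntegral.integral_const_mul, intervalIntegral.integral_const_mul] at hfin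
  set X := ∫ t in (0 : ℝ)..T, ‖v t - b (ψ t)‖ ^ 2
  set D := 4 * A + 2 * T * B ^ 2 with hDdef
  have hDnn : 0 ≤ D := by
    have : 0 ≤ A := by linarith
    positivity
  have h5 : (1 + h⁻¹) * ∫ t in (0 : ℝ)..T, ‖b (ψ t) - b (χ t)‖ ^ 2 ≤ 8 * L ^ 2 * D * h := by
    calc _ ≤ (1 + h⁻¹) * (4 * L ^ 2 * h ^ 2 * D) := by
          gcongr
          exact herr.trans (by gcongr)
      _ = 4 * L ^ 2 * D * h * (h + 1) := by field_simp
      _ ≤ 4 * L ^ 2 * D * h * 2 := by gcongr; linarith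
      _ = _ := by ring
  nlinarith [mul_le_mul_of_nonneg_right hA hh.le]

end Comparison

lemma isH1Path_segment [CompleteSpace E] (T : ℝ) (x₀ x : E) :
    IsH1Path T x₀ (fun t => x₀ + t • (T⁻¹ • (x - x₀))) (fun _ => T⁻¹ • (x - x₀)) where
  integrable := by simp
  integrable_sq := by simp
  eq_integral t _ := by rw [intervalIntegral.integral_const, sub_zero]

lemma exists_mem_sampledActionValues_le [CompleteSpace E] {h : ℝ} {N : ℕ} (hh : 0 < h) (hN : 0 < N)
    {b : E → E} {L : NNReal} (hb : LipschitzWith L b) (hb0 : ‖b 0‖ ≤ (L : ℝ)) (x₀ x : E)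
    {S : (ℝ → E) → ℝ → E}
    (hS : ∀ φ v, IsH1Path (N * h) x₀ φ v → IsSampling h N φ v (S φ))
    {M : ℝ} (hM : ‖x - x₀‖ ≤ M) :
    ∃ r ∈ sampledActionValues (N * h) x₀ b S x,
      r ≤ (1 / 2) * ((N * h) * ((N * h)⁻¹ * M + L * (1 + (‖x₀‖ + M))) ^ 2) := by
  have hT : 0 < (N : ℝ) * h := by positivity
  set T : ℝ := N * h with hTdef
  have hφ := isH1Path_segment T x₀ x
  have hψ := hS _ _ hφ
  refine ⟨_, ⟨_, _, hφ, by simp [hT.ne'], rfl⟩, ?_⟩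
  have hnorm : ‖T⁻¹ • (x - x₀)‖ = T⁻¹ * ‖x - x₀‖ := by
    rw [norm_smul, Real.norm_of_nonneg (by positivity)]
  have hlen : ∫ s in (0 : ℝ)..T, ‖T⁻¹ • (x - x₀)‖ = ‖x - x₀‖ := by
    rw [intervalIntegral.integral_const, hnorm, smul_eq_mul]; field_simp; simp
  have hi := ((hφ.memLp.sub (hψ.memLp_comp hh hN hφ hb hb0)).integrable_norm_pow
    two_ne_zero)
  have hle := intervalIntegral.integral_mono_on hT.le
    (intervalIntegrable_of_Icc hi ⟨le_rfl, hT.le⟩ ⟨hT.le, le_rfl⟩)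
    (intervalIntegrable_const (c := (T⁻¹ * M + L * (1 + (‖x₀‖ + M))) ^ 2)) fun t ht => by
      have h1 := hφ.norm_sampling_le_total hh hN hψ ht
      rw [hlen] at h1
      have h2 := norm_le_of_lipschitz hb hb0 (S (fun t => x₀ + t • (T⁻¹ • (x - x₀))) t)
      simp only [Pi.sub_apply]
      gcongr
      refine (norm_sub_le _ _).trans (add_le_add ?_ (h2.trans ?_))
      · rw [hnorm]; gcongr
      · gcongr; linarith
  rw [intervalIntegral.integral_const, sub_zero, smul_eq_mul] at hle
  gcongr
  exact hle

lemma sampledActionValues_bddBelow {T : ℝ} (hT : 0 ≤ T) (x₀ x : E) (b : E → E)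
    (S : (ℝ → E) → ℝ → E) : BddBelow (sampledActionValues T x₀ b S x) := by
  refine ⟨0, ?_⟩
  rintro r ⟨φ, v, -, -, rfl⟩
  exact mul_nonneg (by norm_num) (intervalIntegral.integral_nonneg hT fun t _ => sq_nonneg _)

lemma sInf_sampledActionValues_le [CompleteSpace E] {h : ℝ} {N : ℕ} (hh : 0 < h) (hh1 : h ≤ 1)
    (hN : 0 < N) {b : E → E} {L : NNReal} (hb : LipschitzWith L b) (hb0 : ‖b 0‖ ≤ (L : ℝ))
    (hLh : L * h ≤ 1 / 2) (x₀ x : E) {S S' : (ℝ → E) → ℝ → E}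
    (hS : ∀ φ v, IsH1Path (N * h) x₀ φ v → IsSampling h N φ v (S φ))
    (hS' : ∀ φ v, IsH1Path (N * h) x₀ φ v → IsSampling h N φ v (S' φ))
    {M A B : ℝ} (hM : ‖x - x₀‖ ≤ M)
    (hA : (1 / 2) * ((N * h) * ((N * h)⁻¹ * M + L * (1 + (‖x₀‖ + M))) ^ 2) ≤ A)
    (hB : L * (1 + Real.exp (2 * L * (N * h)) *
      (‖x₀‖ + 2 * L * (N * h) + (N * h + 2 * A))) ≤ B) :
    sInf (sampledActionValues (N * h) x₀ b S' x) ≤ sInf (sampledActionValues (N * h) x₀ b S x) +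
      (A + 4 * L ^ 2 * (4 * A + 2 * (N * h) * B ^ 2)) * h := by
  have hT : 0 ≤ (N : ℝ) * h := by positivity
  obtain ⟨r₀, hr₀, -⟩ := exists_mem_sampledActionValues_le hh hN hb hb0 x₀ x hS hM
  obtain ⟨r₁, hr₁, hr₁A⟩ := exists_mem_sampledActionValues_le hh hN hb hb0 x₀ x hS' hM
  have hbdd := sampledActionValues_bddBelow hT x₀ x b S'
  rw [← sub_le_iff_le_add]
  refine le_csInf ⟨r₀, hr₀⟩ ?_
  rintro r ⟨φ, v, hφ, hφT, rfl⟩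
  rw [sub_le_iff_le_add]
  rcases le_total ((1 / 2) * ∫ t in (0 : ℝ)..(N * h), ‖v t - b (S φ t)‖ ^ 2) A with hle | hle
  · exact (csInf_le hbdd ⟨φ, v, hφ, hφT, rfl⟩).trans
      (hφ.action_le_action_add hh hh1 hN (hS φ v hφ) (hS' φ v hφ) hb hb0 hLh hle hB)
  · have hA0 : 0 ≤ A := le_trans (by positivity) hA
    have : 0 ≤ (A + 4 * L ^ 2 * (4 * A + 2 * (N * h) * B ^ 2)) * h := by positivity
    linarith [csInf_le hbdd hr₁]

end SampledAction

lemma gridHat_mem_Icc {h t : ℝ} (hh : 0 < h) {n : ℕ}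
    (ht : t ∈ Icc ((n : ℝ) * h) ((n + 1 : ℕ) * h)) :
    gridHat h t ∈ Icc ((n : ℝ) * h) ((n + 1 : ℕ) * h) := by
  unfold gridHat
  constructor
  · rw [mul_comm h]
    gcongr
    have : (n : ℤ) ≤ ⌊t / h⌋ := Int.le_floor.2 (by simpa using (le_div_iff₀ hh).2 ht.1)
    exact_mod_cast this
  · refine le_trans ?_ ht.2
    rw [mul_comm]
    exact (le_div_iff₀ hh).1 (Int.floor_le _)

lemma gridCheck_mem_Icc {h t : ℝ} (hh : 0 < h) {n : ℕ}
    (ht : t ∈ Icc ((n : ℝ) * h) ((n + 1 : ℕ) * h)) :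
    gridCheck h t ∈ Icc ((n : ℝ) * h) ((n + 1 : ℕ) * h) := by
  unfold gridCheck
  constructor
  · refine le_trans ht.1 ?_
    rw [mul_comm h]
    exact (div_le_iff₀ hh).1 (Int.le_ceil _)
  · rw [mul_comm h]
    gcongr
    have : ⌈t / h⌉ ≤ ((n + 1 : ℕ) : ℤ) :=
      Int.ceil_le.2 (by simpa using (div_le_iff₀ hh).2 ht.2)
    exact_mod_cast this

lemma IsH1Path.isSampling_theta {E : Type*} [NormedAddCommGroup E] [NormedSpace ℝ E] {h : ℝ}
    {N : ℕ} (hh : 0 < h) {θ : ℝ} (hθ0 : 0 ≤ θ) (hθ1 : θ ≤ 1) {x₀ : E} {φ v : ℝ → E}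
    (hφ : IsH1Path (N * h) x₀ φ v) :
    IsSampling h N φ v (fun t => (1 - θ) • φ (gridHat h t) + θ • φ (gridCheck h t)) where
  aesm := by
    have key : ∀ f : ℝ → ℤ, Measurable f → StronglyMeasurable fun t => φ (h * (f t : ℝ)) :=
      fun f hf => (StronglyMeasurable.of_discrete
        (f := fun k : ℤ => φ (h * (k : ℝ)))).comp_measurable hf
    have h1 := key (fun t => ⌊t / h⌋) (by fun_prop)
    have h2 := key (fun t => ⌈t / h⌉) (by fun_prop)
    exact ((h1.const_smul (1 - θ)).add (h2.const_smul θ)).aestronglyMeasurable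
  close n hn t ht := by
    have hα := (grid_mem_Icc hh.le hn.le).1
    have hβ := (grid_mem_Icc hh.le (Nat.succ_le_of_lt hn)).2
    have h1 := hφ.norm_sub_le hα hβ (gridHat_mem_Icc hh ht)
    have h2 := hφ.norm_sub_le hα hβ (gridCheck_mem_Icc hh ht)
    simpa [Metric.mem_closedBall, dist_eq_norm] using
      convex_closedBall (φ (n * h)) (∫ s in ((n : ℝ) * h)..((n + 1 : ℕ) * h), ‖v s‖)
        (mem_closedBall_iff_norm.2 h1) (mem_closedBall_iff_norm.2 h2)
        (sub_nonneg.2 hθ1) hθ0 (sub_add_cancel 1 θ)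

/-- In the additive-noise case `σ = I_d`, the discrete rate function `I^h`
of the stochastic θ-method converges to `I` with order 1, uniformly on bounded sets:
for every `R > 0` there is `K₂(R) > 0` such that for all `h = T/N ∈ (0, min(1/(2L),1)]`,
`sup_{|x| ≤ R} |I^h(x) − I(x)| ≤ K₂(R) h`. -/
theorem discrete_rate_function_convergence_additive
    (d : ℕ) (hd : 1 ≤ d) (T : ℝ) (hT : 0 < T)
    (x₀ : EuclideanSpace ℝ (Fin d)) (L : NNReal) (hL : 0 < L)
    (θ : ℝ) (hθ0 : 0 ≤ θ) (hθ1 : θ ≤ 1)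
    (b : EuclideanSpace ℝ (Fin d) → EuclideanSpace ℝ (Fin d))
    (hb : LipschitzWith L b) (hbound : ‖b 0‖ ≤ (L : ℝ)) :
    ∀ R : ℝ, 0 < R → ∃ K₂ : ℝ, 0 < K₂ ∧
      ∀ N : ℕ, 0 < N → T / (N : ℝ) ≤ min (1 / (2 * (L : ℝ))) 1 →
      ∀ x : EuclideanSpace ℝ (Fin d), ‖x‖ ≤ R →
        |sInf (rateValuesIdH d T x₀ θ b (T / (N : ℝ)) x) -
          sInf (rateValuesId d T x₀ b x)| ≤ K₂ * (T / (N : ℝ)) := by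
  intro R hR
  set M : ℝ := R + ‖x₀‖
  set A : ℝ := (1 / 2) * (T * (T⁻¹ * M + L * (1 + (‖x₀‖ + M))) ^ 2) with hAdef
  set B : ℝ := L * (1 + Real.exp (2 * L * T) * (‖x₀‖ + 2 * L * T + (T + 2 * A))) with hBdef
  have hLpos : (0 : ℝ) < L := hL
  have hM : 0 < M := by positivity
  have hA : 0 < A := by positivity
  refine ⟨A + 4 * L ^ 2 * (4 * A + 2 * T * B ^ 2), by positivity, ?_⟩
  intro N hN hle x hx
  have hNpos : (0 : ℝ) < N := by exact_mod_cast hN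
  obtain ⟨hhL, hh1⟩ := le_min_iff.1 hle
  set h : ℝ := T / N with hhdef
  have hh : 0 < h := by positivity
  have hTN : T = N * h := by rw [hhdef]; field_simp
  have hLh : L * h ≤ 1 / 2 := by
    calc (L : ℝ) * h ≤ L * (1 / (2 * L)) := by gcongr
      _ = 1 / 2 := by field_simp
  have hxM : ‖x - x₀‖ ≤ M := (norm_sub_le _ _).trans (add_le_add_left hx _)
  have hI : rateValuesId d T x₀ b x = sampledActionValues T x₀ b (fun φ t => φ t) x := by
    ext r
    exact ⟨fun ⟨φ, v, h1, h2, h3, h4⟩ => ⟨φ, v, ⟨h1, h2, h3⟩, h4⟩,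
      fun ⟨φ, v, ⟨h1, h2, h3⟩, h4⟩ => ⟨φ, v, h1, h2, h3, h4⟩⟩
  have hIh : rateValuesIdH d T x₀ θ b h x = sampledActionValues T x₀ b
      (fun φ t => (1 - θ) • φ (gridHat h t) + θ • φ (gridCheck h t)) x := by
    ext r
    exact ⟨fun ⟨φ, v, h1, h2, h3, h4⟩ => ⟨φ, v, ⟨h1, h2, h3⟩, h4⟩,
      fun ⟨φ, v, ⟨h1, h2, h3⟩, h4⟩ => ⟨φ, v, h1, h2, h3, h4⟩⟩
  rw [hI, hIh]
  clear_value h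
  rw [hTN] at hAdef hBdef ⊢
  have hS : ∀ φ v : ℝ → EuclideanSpace ℝ (Fin d), IsH1Path (N * h) x₀ φ v →
      IsSampling h N φ v (fun t => φ t) := fun φ v hφ => hφ.isSampling_self hh.le
  have hS' : ∀ φ v : ℝ → EuclideanSpace ℝ (Fin d), IsH1Path (N * h) x₀ φ v →
      IsSampling h N φ v (fun t => (1 - θ) • φ (gridHat h t) + θ • φ (gridCheck h t)) :=
    fun φ v hφ => hφ.isSampling_theta hh hθ0 hθ1
  have h1 := sInf_sampledActionValues_le hh hh1 hN hb hbound hLh x₀ x hS hS' hxM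
    hAdef.ge hBdef.ge
  have h2 := sInf_sampledActionValues_le hh hh1 hN hb hbound hLh x₀ x hS' hS hxM
    hAdef.ge hBdef.ge
  rw [abs_le]
  constructor <;> linarith
end

section
/- Let b : ℝ^d → ℝ^d and σ : ℝ^d → ℝ^{d×d} be globally Lipschitz with constant L and satisfy |b(0)| + |σ(0)| ≤ L. Let X⁰ solve X⁰(t) = x₀ + ∫₀^t b(X⁰(s)) ds. Suppose φ : [0,T] → ℝ^d is continuous, f ∈ L²(0,T;ℝ^d), φ(t) = x₀ + ∫₀^t b(φ(s)) ds + ∫₀^t σ(φ(s)) f(s) ds for all t ∈ [0,T], and sup_{t∈[0,T]} |φ(t)| ≤ K for some constant K > 0. Then |φ(t) − X⁰(t)| ≤ e^{Lt} L(1+K)√T ‖f‖_{L²} for every t ∈ [0,T]. -/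
open MeasureTheory Set

/-- **Grönwall's inequality**, integral form with constant coefficients. -/
theorem le_mul_exp_of_le_add_mul_integral {u : ℝ → ℝ} {a b C k : ℝ} (hk : 0 ≤ k)
    (hu : ContinuousOn u (Icc a b))
    (hle : ∀ t ∈ Icc a b, u t ≤ C + k * ∫ s in a..t, u s) :
    ∀ t ∈ Icc a b, u t ≤ C * Real.exp (k * (t - a)) := by
  intro t ht
  have hab : a ≤ b := ht.1.trans ht.2
  set w : ℝ → ℝ := IccExtend hab ((Icc a b).domRestrict u)
  have hw : Continuous w := hu.domRestrict.Icc_extend'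
  have hwu : ∀ s ∈ Icc a b, w s = u s := fun s hs =>
    IccExtend_of_mem hab _ hs
  have hle' : ∀ s ∈ Icc a b, w s ≤ C + k * ∫ r in a..s, w r := by
    intro s hs
    have hint : ∫ r in a..s, w r = ∫ r in a..s, u r :=
      intervalIntegral.integral_congr fun r hr => by
        rw [uIcc_of_le hs.1] at hr
        exact hwu r ⟨hr.1, hr.2.trans hs.2⟩
    rw [hwu s hs, hint]
    exact hle s hs
  have hderiv : ∀ s, HasDerivAt (fun s => C + k * ∫ r in a..s, w r) (k * w s) s := fun s =>
    ((hw.integral_hasStrictDerivAt a s).hasDerivAt.const_mul k).const_add C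
  have hV := le_gronwallBound_of_liminf_deriv_right_le
    (f := fun s => C + k * ∫ r in a..s, w r) (f' := fun s => k * w s)
    (δ := C) (K := k) (ε := 0) (a := a) (b := b)
    (fun s _ => (hderiv s).continuousAt.continuousWithinAt)
    (fun s _ _ hr => (hderiv s).hasDerivWithinAt.liminf_right_slope_le hr)
    (by simp)
    (fun s hs => by
      rw [add_zero]
      exact mul_le_mul_of_nonneg_left (hle' s (Ico_subset_Icc_self hs)) hk)
    t ht
  rw [gronwallBound_ε0] at hV
  rw [← hwu t ht]
  exact (hle' t ht).trans hV

/-- The **Cauchy–Schwarz inequality** against the constant function `1` on an interval. -/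
theorem intervalIntegral_le_sqrt_mul_sqrt_integral_sq {g : ℝ → ℝ} {a b : ℝ} (hab : a < b)
    (hg : IntervalIntegrable g volume a b)
    (hg2 : IntervalIntegrable (fun t => g t ^ 2) volume a b) :
    ∫ s in a..b, g s ≤ Real.sqrt (b - a) * Real.sqrt (∫ s in a..b, g s ^ 2) := by
  have hpos : 0 < b - a := sub_pos.2 hab
  rw [← Real.sqrt_mul hpos.le]
  apply Real.le_sqrt_of_sq_le
  set I := ∫ s in a..b, g s
  set m := I / (b - a) with hm
  have hnonneg : 0 ≤ ∫ s in a..b, (g s - m) ^ 2 :=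
    intervalIntegral.integral_nonneg hab.le fun s _ => sq_nonneg _
  have hexpand : ∫ s in a..b, (g s - m) ^ 2
      = (∫ s in a..b, g s ^ 2) - 2 * m * I + (b - a) * m ^ 2 := by
    have hfun : (fun s => (g s - m) ^ 2) = fun s => g s ^ 2 - 2 * m * g s + m ^ 2 := by
      ext s; ring
    rw [hfun, intervalIntegral.integral_add (hg2.sub (hg.const_mul _)) (by simp),
      intervalIntegral.integral_sub hg2 (hg.const_mul _), intervalIntegral.integral_const_mul,
      intervalIntegral.integral_const, smul_eq_mul]
  have hI : I = m * (b - a) := by rw [hm]; field_simp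
  rw [hexpand] at hnonneg
  rw [hI] at hnonneg ⊢
  nlinarith [mul_nonneg hpos.le hnonneg]

/-- If `X⁰` solves `X⁰(t) = x₀ + ∫₀ᵗ b(X⁰(s)) ds` and `φ` solves the
controlled ODE `φ(t) = x₀ + ∫₀ᵗ b(φ(s)) ds + ∫₀ᵗ σ(φ(s)) f(s) ds` with
`sup_{[0,T]}|φ| ≤ K`, then `|φ(t) − X⁰(t)| ≤ e^{Lt} L(1+K)√T ‖f‖_{L²}` on `[0,T]`. -/
theorem controlled_ode_distance_to_ode
    (d : ℕ) (hd : 1 ≤ d) (T : ℝ) (hT : 0 < T)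
    (x₀ : EuclideanSpace ℝ (Fin d)) (L : NNReal) (hL : 0 < L)
    (b : EuclideanSpace ℝ (Fin d) → EuclideanSpace ℝ (Fin d))
    (σ : EuclideanSpace ℝ (Fin d) →
      (EuclideanSpace ℝ (Fin d) →L[ℝ] EuclideanSpace ℝ (Fin d)))
    (hb : LipschitzWith L b) (hσ : LipschitzWith L σ)
    (hbound : ‖b 0‖ + ‖σ 0‖ ≤ (L : ℝ))
    (X₀ : ℝ → EuclideanSpace ℝ (Fin d))
    (hX₀cont : ContinuousOn X₀ (Icc 0 T))
    (hX₀ : ∀ t ∈ Icc (0 : ℝ) T, X₀ t = x₀ + ∫ s in (0 : ℝ)..t, b (X₀ s))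
    (φ : ℝ → EuclideanSpace ℝ (Fin d)) (f : ℝ → EuclideanSpace ℝ (Fin d))
    (hφcont : ContinuousOn φ (Icc 0 T))
    (hfInt : IntegrableOn f (Icc 0 T))
    (hfSq : IntegrableOn (fun t => ‖f t‖ ^ 2) (Icc 0 T))
    (heq : ∀ t ∈ Icc (0 : ℝ) T, φ t = x₀ + (∫ s in (0 : ℝ)..t, b (φ s))
      + ∫ s in (0 : ℝ)..t, (σ (φ s)) (f s))
    (K : ℝ) (hK : 0 < K) (hφK : ∀ t ∈ Icc (0 : ℝ) T, ‖φ t‖ ≤ K) :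
    ∀ t ∈ Icc (0 : ℝ) T,
      ‖φ t - X₀ t‖ ≤ Real.exp ((L : ℝ) * t) * (L : ℝ) * (1 + K) * Real.sqrt T *
        Real.sqrt (∫ s in (0 : ℝ)..T, ‖f s‖ ^ 2) := by
  have hφ0 : ∀ s ∈ Icc (0 : ℝ) T, ‖σ (φ s)‖ ≤ L * (1 + K) := fun s hs => by
    have h₁ : ‖σ (φ s) - σ 0‖ ≤ L * ‖φ s‖ := by simpa using hσ.norm_sub_le (φ s) 0
    have h₂ : ‖σ (φ s)‖ ≤ ‖σ (φ s) - σ 0‖ + ‖σ 0‖ := by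
      simpa using norm_add_le (σ (φ s) - σ 0) (σ 0)
    have h₃ : (L : ℝ) * ‖φ s‖ ≤ L * K := mul_le_mul_of_nonneg_left (hφK s hs) L.coe_nonneg
    linarith [norm_nonneg (b 0)]
  have hfI : IntervalIntegrable (fun s => ‖f s‖) volume 0 T :=
    (intervalIntegrable_iff_integrableOn_Icc_of_le hT.le).2 hfInt.norm
  have hf2I : IntervalIntegrable (fun s => ‖f s‖ ^ 2) volume 0 T :=
    (intervalIntegrable_iff_integrableOn_Icc_of_le hT.le).2 hfSq
  have hCS := intervalIntegral_le_sqrt_mul_sqrt_integral_sq hT hfI hf2I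
  rw [sub_zero] at hCS
  have hLK : 0 ≤ (L : ℝ) * (1 + K) := by positivity
  have hcontrol : ∀ t ∈ Icc (0 : ℝ) T, ‖∫ s in (0 : ℝ)..t, (σ (φ s)) (f s)‖ ≤
      L * (1 + K) * (Real.sqrt T * Real.sqrt (∫ s in (0 : ℝ)..T, ‖f s‖ ^ 2)) := fun t ht => by
    have hft : IntervalIntegrable (fun s => ‖f s‖) volume 0 t :=
      hfI.mono_set (uIcc_subset_uIcc_left (by rwa [uIcc_of_le hT.le]))
    calc ‖∫ s in (0 : ℝ)..t, (σ (φ s)) (f s)‖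
        ≤ ∫ s in (0 : ℝ)..t, L * (1 + K) * ‖f s‖ :=
          intervalIntegral.norm_integral_le_of_norm_le ht.1
            (.of_forall fun s hs => (σ (φ s)).le_of_opNorm_le
              (hφ0 s ⟨hs.1.le, hs.2.trans ht.2⟩) (f s)) (hft.const_mul _)
      _ = L * (1 + K) * ∫ s in (0 : ℝ)..t, ‖f s‖ := intervalIntegral.integral_const_mul _ _
      _ ≤ L * (1 + K) * ∫ s in (0 : ℝ)..T, ‖f s‖ :=
          mul_le_mul_of_nonneg_left (intervalIntegral.integral_mono_interval le_rfl ht.1 ht.2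
            (.of_forall fun s => norm_nonneg _) hfI) hLK
      _ ≤ _ := mul_le_mul_of_nonneg_left hCS hLK
  have hgron := le_mul_exp_of_le_add_mul_integral (u := fun t => ‖φ t - X₀ t‖) (a := 0) (b := T)
    L.coe_nonneg (hφcont.sub hX₀cont).norm (C := L * (1 + K) *
      (Real.sqrt T * Real.sqrt (∫ s in (0 : ℝ)..T, ‖f s‖ ^ 2))) fun t ht => by
    have hsub : Icc 0 t ⊆ Icc 0 T := Icc_subset_Icc_right ht.2
    have hint : ∀ {g : ℝ → EuclideanSpace ℝ (Fin d)}, ContinuousOn g (Icc 0 T) →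
        IntervalIntegrable g volume 0 t := fun hg =>
      (hg.mono hsub).intervalIntegrable_of_Icc ht.1
    have hdiff : φ t - X₀ t = (∫ s in (0 : ℝ)..t, (σ (φ s)) (f s))
        + ∫ s in (0 : ℝ)..t, (b (φ s) - b (X₀ s)) := by
      rw [intervalIntegral.integral_sub (hint (hb.continuous.comp_continuousOn' hφcont))
        (hint (hb.continuous.comp_continuousOn' hX₀cont)), heq t ht, hX₀ t ht]
      abel
    have hdrift : ‖∫ s in (0 : ℝ)..t, (b (φ s) - b (X₀ s))‖ ≤
        L * ∫ s in (0 : ℝ)..t, ‖φ s - X₀ s‖ := by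
      rw [← intervalIntegral.integral_const_mul]
      exact intervalIntegral.norm_integral_le_of_norm_le ht.1
        (.of_forall fun s _ => hb.norm_sub_le _ _)
        ((hint (hφcont.sub hX₀cont)).norm.const_mul _)
    change ‖φ t - X₀ t‖ ≤ _
    rw [hdiff]
    exact (norm_add_le _ _).trans (add_le_add (hcontrol t ht) hdrift)
  intro t ht
  refine (hgron t ht).trans_eq ?_
  rw [sub_zero]
  ring
end

section
/- Let b : ℝ^d → ℝ^d and σ : ℝ^d → ℝ^{d×d} be globally Lipschitz with constant L and satisfy |b(0)| + |σ(0)| ≤ L, and suppose σ(x) is invertible for every x ∈ ℝ^d. Fix θ ∈ [0,1], T > 0, N ∈ ℕ⁺, h = T/N ≤ 1/(2L), and the grid t_n = nh with nodal projections t̂, ť. Let φ : [0,T] → ℝ^d be continuous with φ(0) = x₀. Then there exists f ∈ L²(0,T;ℝ^d) such that φ(t) = x₀ + ∫₀^t b((1−θ)φ(ŝ) + θφ(š)) ds + ∫₀^t σ(φ(ŝ)) f(s) ds for all t ∈ [0,T] if and only if φ is absolutely continuous with φ' ∈ L²(0,T;ℝ^d); moreover, in that case the infimum of (1/2)∫₀^T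 |f(t)|² dt over all such f equals B_h(φ) = (1/2)∫₀^T |σ(φ(t̂))^{-1}(φ'(t) − b((1−θ)φ(t̂) + θφ(ť)))|² dt. -/
open MeasureTheory Set

/-- A function of the two neighbouring grid indices is strongly measurable. -/
theorem stronglyMeasurable_gridIndex {F : Type*} [TopologicalSpace F] (g : ℤ × ℤ → F) (h : ℝ) :
    StronglyMeasurable fun s : ℝ => g (⌊s / h⌋, ⌈s / h⌉) :=
  (StronglyMeasurable.of_discrete (f := g)).comp_measurable
    ((Int.measurable_floor.comp (measurable_id.div_const h)).prodMk
      (Int.measurable_ceil.comp (measurable_id.div_const h)))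

/-- A function of the two neighbouring grid indices is bounded on `[0, T]`. -/
theorem exists_norm_gridIndex_le {F : Type*} [SeminormedAddCommGroup F] (g : ℤ × ℤ → F)
    {h : ℝ} (hh : 0 < h) (T : ℝ) :
    ∃ C, ∀ s ∈ Icc (0 : ℝ) T, ‖g (⌊s / h⌋, ⌈s / h⌉)‖ ≤ C := by
  obtain ⟨C, hC⟩ := ((Finset.Icc (0 : ℤ) ⌈T / h⌉ ×ˢ Finset.Icc (0 : ℤ) ⌈T / h⌉).image
    fun p => ‖g p‖).bddAbove
  refine ⟨C, fun s hs => hC ?_⟩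
  have h0 : 0 ≤ s / h := div_nonneg hs.1 hh.le
  have h1 : ⌈s / h⌉ ≤ ⌈T / h⌉ := Int.ceil_mono (div_le_div_of_nonneg_right hs.2 hh.le)
  have h2 : ⌊s / h⌋ ≤ ⌈s / h⌉ := Int.floor_le_ceil _
  have h3 : 0 ≤ ⌊s / h⌋ := Int.floor_nonneg.2 h0
  simp only [Finset.coe_image, mem_image, Finset.mem_coe, Finset.mem_product, Finset.mem_Icc]
  exact ⟨_, ⟨⟨h3, h2.trans h1⟩, h3.trans h2, h1⟩, rfl⟩

/-- Being integrable and square integrable on a bounded interval is membership in `L²`. -/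
theorem integrableOn_and_sq_iff_memLp_two {E : Type*} [NormedAddCommGroup E] {f : ℝ → E}
    {a b : ℝ} :
    (IntegrableOn f (Icc a b) ∧ IntegrableOn (fun t => ‖f t‖ ^ 2) (Icc a b)) ↔
      MemLp f 2 (volume.restrict (Icc a b)) :=
  ⟨fun h => (memLp_two_iff_integrable_sq_norm h.1.aestronglyMeasurable).2 h.2,
    fun h => ⟨h.integrable one_le_two, (memLp_two_iff_integrable_sq_norm h.1).1 h⟩⟩

/-- Applying an essentially bounded family of operators preserves `L^p`. -/
theorem MeasureTheory.MemLp.clm_apply_of_bound {α E F : Type*} [MeasurableSpace α]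
    {μ : Measure α} [NormedAddCommGroup E] [NormedSpace ℝ E] [NormedAddCommGroup F]
    [NormedSpace ℝ F] {p : ENNReal} {f : α → E} {A : α → E →L[ℝ] F} (hf : MemLp f p μ)
    (hA : AEStronglyMeasurable A μ) {C : ℝ} (hC : ∀ᵐ s ∂μ, ‖A s‖ ≤ C) :
    MemLp (fun s => A s (f s)) p μ := by
  refine hf.of_le_mul
    ((ContinuousLinearMap.id ℝ (E →L[ℝ] F)).aestronglyMeasurable_comp₂ hA hf.1) (c := C) ?_
  filter_upwards [hC] with s hs
  exact (A s).le_of_opNorm_le hs _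

/-- Integrable functions with the same primitive on `[a, b]` agree almost everywhere there. -/
theorem ae_eq_of_forall_intervalIntegral_eq {E : Type*} [NormedAddCommGroup E] [NormedSpace ℝ E]
    [CompleteSpace E] {f g : ℝ → E} {a b : ℝ} (hab : a ≤ b) (hf : IntegrableOn f (Icc a b))
    (hg : IntegrableOn g (Icc a b))
    (h : ∀ t ∈ Icc a b, ∫ s in a..t, f s = ∫ s in a..t, g s) :
    f =ᵐ[volume.restrict (Icc a b)] g := by
  have hf' := ((intervalIntegrable_iff_integrableOn_Icc_of_le hab).2 hf).ae_hasDerivAt_integral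
  have hg' := ((intervalIntegrable_iff_integrableOn_Icc_of_le hab).2 hg).ae_hasDerivAt_integral
  rw [uIcc_of_le hab] at hf' hg'
  rw [← restrict_Ioo_eq_restrict_Icc]
  refine (ae_restrict_iff' measurableSet_Ioo).2 ?_
  filter_upwards [hf', hg'] with x hfx hgx hx
  have hx' := Ioo_subset_Icc_self hx
  have ha := left_mem_Icc.2 hab
  refine (hfx hx' a ha).unique ((hgx hx' a ha).congr_of_eventuallyEq ?_)
  filter_upwards [Icc_mem_nhds hx.1 hx.2] with t ht using h t ht

section LinearControl

variable {E : Type*} [NormedAddCommGroup E] [NormedSpace ℝ E] {T : ℝ} {B φ : ℝ → E} {x₀ : E}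
  {S : ℝ → E →L[ℝ] E}

/-- An `L²` control of `φ` through a bounded operator family gives `φ` an `L²` derivative. -/
theorem memLp_two_drift_add_control
    (hB : MemLp B 2 (volume.restrict (Icc 0 T)))
    (hS : AEStronglyMeasurable S (volume.restrict (Icc 0 T))) {C : ℝ}
    (hSC : ∀ᵐ s ∂volume.restrict (Icc 0 T), ‖S s‖ ≤ C) {f : ℝ → E}
    (hf : MemLp f 2 (volume.restrict (Icc 0 T)))
    (h : ∀ t ∈ Icc 0 T, φ t = x₀ + (∫ s in (0 : ℝ)..t, B s) + ∫ s in (0 : ℝ)..t, S s (f s)) :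
    MemLp (fun s => B s + S s (f s)) 2 (volume.restrict (Icc 0 T)) ∧
      ∀ t ∈ Icc 0 T, φ t = x₀ + ∫ s in (0 : ℝ)..t, (B s + S s (f s)) := by
  have hSf := hf.clm_apply_of_bound hS hSC
  refine ⟨hB.add hSf, fun t ht => ?_⟩
  have hi {g : ℝ → E} (hg : MemLp g 2 (volume.restrict (Icc 0 T))) :
      IntervalIntegrable g volume 0 t :=
    (intervalIntegrable_iff_integrableOn_Icc_of_le ht.1).2
      (IntegrableOn.mono_set (integrableOn_and_sq_iff_memLp_two.2 hg).1 (Icc_subset_Icc_right ht.2))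
  rw [h t ht, intervalIntegral.integral_add (hi hB) (hi hSf), add_assoc]

variable {R : ℝ → E →L[ℝ] E}

/-- If `φ` has an `L²` derivative and the operator family has a bounded right inverse, then `φ`
is controlled in `L²`. -/
theorem memLp_two_control_of_rightInverse
    (hB : MemLp B 2 (volume.restrict (Icc 0 T)))
    (hR : AEStronglyMeasurable R (volume.restrict (Icc 0 T))) {C : ℝ}
    (hRC : ∀ᵐ s ∂volume.restrict (Icc 0 T), ‖R s‖ ≤ C) (hSR : ∀ s, S s * R s = 1)
    {φ' : ℝ → E} (hφ' : MemLp φ' 2 (volume.restrict (Icc 0 T)))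
    (h : ∀ t ∈ Icc 0 T, φ t = x₀ + ∫ s in (0 : ℝ)..t, φ' s) :
    MemLp (fun s => R s (φ' s - B s)) 2 (volume.restrict (Icc 0 T)) ∧
      ∀ t ∈ Icc 0 T, φ t = x₀ + (∫ s in (0 : ℝ)..t, B s) +
        ∫ s in (0 : ℝ)..t, S s (R s (φ' s - B s)) := by
  refine ⟨(hφ'.sub hB).clm_apply_of_bound hR hRC, fun t ht => ?_⟩
  have hi {g : ℝ → E} (hg : MemLp g 2 (volume.restrict (Icc 0 T))) :
      IntervalIntegrable g volume 0 t :=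
    (intervalIntegrable_iff_integrableOn_Icc_of_le ht.1).2
      (IntegrableOn.mono_set (integrableOn_and_sq_iff_memLp_two.2 hg).1 (Icc_subset_Icc_right ht.2))
  have hSR' (s : ℝ) (v : E) : S s (R s v) = v := by
    simpa using congrArg (fun A : E →L[ℝ] E => A v) (hSR s)
  simp only [hSR']
  rw [h t ht, intervalIntegral.integral_sub (hi hφ') (hi hB)]
  abel

/-- A control of `φ` through a left-invertible operator family is determined almost everywhere. -/
theorem control_ae_eq [CompleteSpace E] (hT : 0 ≤ T)
    (hB : MemLp B 2 (volume.restrict (Icc 0 T)))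
    (hS : AEStronglyMeasurable S (volume.restrict (Icc 0 T))) {C : ℝ}
    (hSC : ∀ᵐ s ∂volume.restrict (Icc 0 T), ‖S s‖ ≤ C) (hRS : ∀ s, R s * S s = 1)
    {f φ' : ℝ → E} (hf : MemLp f 2 (volume.restrict (Icc 0 T)))
    (hφ' : MemLp φ' 2 (volume.restrict (Icc 0 T)))
    (h : ∀ t ∈ Icc 0 T, φ t = x₀ + (∫ s in (0 : ℝ)..t, B s) + ∫ s in (0 : ℝ)..t, S s (f s))
    (h' : ∀ t ∈ Icc 0 T, φ t = x₀ + ∫ s in (0 : ℝ)..t, φ' s) :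
    f =ᵐ[volume.restrict (Icc 0 T)] fun s => R s (φ' s - B s) := by
  obtain ⟨hg, hgφ⟩ := memLp_two_drift_add_control hB hS hSC hf h
  filter_upwards [ae_eq_of_forall_intervalIntegral_eq hT
    (integrableOn_and_sq_iff_memLp_two.2 hg).1 (integrableOn_and_sq_iff_memLp_two.2 hφ').1
    fun t ht => add_left_cancel ((hgφ t ht).symm.trans (h' t ht))] with s hs
  rw [← hs, add_sub_cancel_left]
  simpa using (congrArg (fun A : E →L[ℝ] E => A (f s)) (hRS s)).symm

end LinearControl

/-- For a continuous `φ` with `φ(0) = x₀` and grid step `h = T/N ≤ 1/(2L)`,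
there exists `f ∈ L²(0,T;ℝ^d)` with
`φ(t) = x₀ + ∫₀ᵗ b((1−θ)φ(ŝ)+θφ(š)) ds + ∫₀ᵗ σ(φ(ŝ)) f(s) ds` iff `φ` is absolutely
continuous with `φ' ∈ L²`; and in that case the infimum of `½∫₀ᵀ|f|²` over all such `f`
equals `B_h(φ) = ½∫₀ᵀ |σ(φ(t̂))⁻¹(φ'(t) − b((1−θ)φ(t̂)+θφ(ť)))|² dt`. -/
theorem discrete_skeleton_functional_domain_and_value
    (d : ℕ) (hd : 1 ≤ d) (T : ℝ) (hT : 0 < T)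
    (x₀ : EuclideanSpace ℝ (Fin d)) (L : NNReal) (hL : 0 < L)
    (θ : ℝ) (hθ0 : 0 ≤ θ) (hθ1 : θ ≤ 1)
    (b : EuclideanSpace ℝ (Fin d) → EuclideanSpace ℝ (Fin d))
    (σ : EuclideanSpace ℝ (Fin d) →
      (EuclideanSpace ℝ (Fin d) →L[ℝ] EuclideanSpace ℝ (Fin d)))
    (hb : LipschitzWith L b) (hσ : LipschitzWith L σ)
    (hbound : ‖b 0‖ + ‖σ 0‖ ≤ (L : ℝ))
    (hinv : ∀ x, IsUnit (σ x))
    (N : ℕ) (hN : 0 < N) (hh : T / (N : ℝ) ≤ 1 / (2 * (L : ℝ)))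
    (φ : ℝ → EuclideanSpace ℝ (Fin d))
    (hφcont : ContinuousOn φ (Icc 0 T)) (hφ0 : φ 0 = x₀) :
    ((∃ f : ℝ → EuclideanSpace ℝ (Fin d),
        IntegrableOn f (Icc 0 T) ∧
        IntegrableOn (fun t => ‖f t‖ ^ 2) (Icc 0 T) ∧
        ∀ t ∈ Icc (0 : ℝ) T, φ t = x₀ +
          (∫ s in (0 : ℝ)..t, b ((1 - θ) • φ (gridHat (T / (N : ℝ)) s)
            + θ • φ (gridCheck (T / (N : ℝ)) s)))
          + ∫ s in (0 : ℝ)..t, (σ (φ (gridHat (T / (N : ℝ)) s))) (f s)) ↔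
      (∃ φ' : ℝ → EuclideanSpace ℝ (Fin d),
        IntegrableOn φ' (Icc 0 T) ∧
        IntegrableOn (fun t => ‖φ' t‖ ^ 2) (Icc 0 T) ∧
        ∀ t ∈ Icc (0 : ℝ) T, φ t = x₀ + ∫ s in (0 : ℝ)..t, φ' s)) ∧
    (∀ φ' : ℝ → EuclideanSpace ℝ (Fin d),
      IntegrableOn φ' (Icc 0 T) →
      IntegrableOn (fun t => ‖φ' t‖ ^ 2) (Icc 0 T) →
      (∀ t ∈ Icc (0 : ℝ) T, φ t = x₀ + ∫ s in (0 : ℝ)..t, φ' s) →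
      sInf {r : ℝ | ∃ f : ℝ → EuclideanSpace ℝ (Fin d),
          IntegrableOn f (Icc 0 T) ∧
          IntegrableOn (fun t => ‖f t‖ ^ 2) (Icc 0 T) ∧
          (∀ t ∈ Icc (0 : ℝ) T, φ t = x₀ +
            (∫ s in (0 : ℝ)..t, b ((1 - θ) • φ (gridHat (T / (N : ℝ)) s)
              + θ • φ (gridCheck (T / (N : ℝ)) s)))
            + ∫ s in (0 : ℝ)..t, (σ (φ (gridHat (T / (N : ℝ)) s))) (f s)) ∧
          r = (1 / 2) * ∫ t in (0 : ℝ)..T, ‖f t‖ ^ 2} =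
        (1 / 2) * ∫ t in (0 : ℝ)..T,
          ‖(Ring.inverse (σ (φ (gridHat (T / (N : ℝ)) t))))
            (φ' t - b ((1 - θ) • φ (gridHat (T / (N : ℝ)) t)
              + θ • φ (gridCheck (T / (N : ℝ)) t)))‖ ^ 2) := by
  have hpos : 0 < T / (N : ℝ) := div_pos hT (Nat.cast_pos.2 hN)
  set h := T / (N : ℝ)
  set B : ℝ → EuclideanSpace ℝ (Fin d) := fun s =>
    b ((1 - θ) • φ (gridHat h s) + θ • φ (gridCheck h s))
  set S : ℝ → (EuclideanSpace ℝ (Fin d) →L[ℝ] EuclideanSpace ℝ (Fin d)) := fun s =>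
    σ (φ (gridHat h s))
  set R : ℝ → (EuclideanSpace ℝ (Fin d) →L[ℝ] EuclideanSpace ℝ (Fin d)) := fun s =>
    Ring.inverse (S s)
  have hSR (s : ℝ) : S s * R s = 1 := Ring.mul_inverse_cancel _ (hinv _)
  have hRS (s : ℝ) : R s * S s = 1 := Ring.inverse_mul_cancel _ (hinv _)
  have bdd {F : Type} [NormedAddCommGroup F] (g : ℤ × ℤ → F) :
      ∃ C, ∀ᵐ s ∂volume.restrict (Icc 0 T), ‖g (⌊s / h⌋, ⌈s / h⌉)‖ ≤ C := by
    obtain ⟨C, hC⟩ := exists_norm_gridIndex_le g hpos T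
    exact ⟨C, ae_restrict_of_forall_mem measurableSet_Icc hC⟩
  let gB : ℤ × ℤ → EuclideanSpace ℝ (Fin d) := fun p =>
    b ((1 - θ) • φ (h * p.1) + θ • φ (h * p.2))
  let gS : ℤ × ℤ → (EuclideanSpace ℝ (Fin d) →L[ℝ] EuclideanSpace ℝ (Fin d)) := fun p =>
    σ (φ (h * p.1))
  have hB : MemLp B 2 (volume.restrict (Icc 0 T)) :=
    (bdd gB).elim fun C hC =>
      MemLp.of_bound (stronglyMeasurable_gridIndex gB h).aestronglyMeasurable C hC
  have hS : AEStronglyMeasurable S (volume.restrict (Icc 0 T)) :=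
    (stronglyMeasurable_gridIndex gS h).aestronglyMeasurable
  have hR : AEStronglyMeasurable R (volume.restrict (Icc 0 T)) :=
    (stronglyMeasurable_gridIndex (fun p => Ring.inverse (gS p)) h).aestronglyMeasurable
  obtain ⟨CS, hCS⟩ : ∃ C, ∀ᵐ s ∂volume.restrict (Icc 0 T), ‖S s‖ ≤ C := bdd gS
  obtain ⟨CR, hCR⟩ : ∃ C, ∀ᵐ s ∂volume.restrict (Icc 0 T), ‖R s‖ ≤ C :=
    bdd fun p => Ring.inverse (gS p)
  refine ⟨⟨?_, ?_⟩, fun φ' hφ1 hφ2 hφ' => ?_⟩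
  · rintro ⟨f, hf1, hf2, hf⟩
    obtain ⟨hg, hgφ⟩ := memLp_two_drift_add_control hB hS hCS
      (integrableOn_and_sq_iff_memLp_two.1 ⟨hf1, hf2⟩) hf
    have hg' := integrableOn_and_sq_iff_memLp_two.2 hg
    exact ⟨_, hg'.1, hg'.2, hgφ⟩
  · rintro ⟨φ', hφ1, hφ2, hφ'⟩
    obtain ⟨hg, hgφ⟩ := memLp_two_control_of_rightInverse hB hR hCR hSR
      (integrableOn_and_sq_iff_memLp_two.1 ⟨hφ1, hφ2⟩) hφ'
    have hg' := integrableOn_and_sq_iff_memLp_two.2 hg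
    exact ⟨_, hg'.1, hg'.2, hgφ⟩
  · have hφL := integrableOn_and_sq_iff_memLp_two.1 ⟨hφ1, hφ2⟩
    refine Eq.trans (congrArg sInf (eq_singleton_iff_unique_mem.2 ⟨?_, ?_⟩)) (csInf_singleton _)
    · obtain ⟨hg, hgφ⟩ := memLp_two_control_of_rightInverse hB hR hCR hSR hφL hφ'
      have hg' := integrableOn_and_sq_iff_memLp_two.2 hg
      exact ⟨_, hg'.1, hg'.2, hgφ, rfl⟩
    · rintro r ⟨f, hf1, hf2, hf, rfl⟩
      have hae := control_ae_eq hT.le hB hS hCS hRS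
        (integrableOn_and_sq_iff_memLp_two.1 ⟨hf1, hf2⟩) hφL hf hφ'
      rw [intervalIntegral.integral_of_le hT.le, intervalIntegral.integral_of_le hT.le,
        ← integral_Icc_eq_integral_Ioc, ← integral_Icc_eq_integral_Ioc]
      congr 1
      refine integral_congr_ae ?_
      filter_upwards [hae] with s hs
      rw [hs]
end
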